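/- arXiv:1609.00553 — 3 statements merged into one kernel-verified Lean document; each statement's English description precedes it below -/
import Mathlib

section
/- Let n≥1 and α,β>0, and let ψ₀(x)=2^{n/4}e^{−π|x|²} be the standard Gaussian on ℝⁿ. The Gabor system 𝒢(ψ₀,α,β)={T_{αk}M_{βm}ψ₀ : k,m∈ℤⁿ} is a frame for L²(ℝⁿ) if and only if αβ<1. -/
noncomputable section
open MeasureTheory Filter Complex Real
open scoped ComplexConjugate BigOperators NNReal ENNReal

namespace SC

variable {n : ℕ}

abbrev Rn (n : ℕ) := Fin n → ℝ
abbrev Ph (n : ℕ) := (Fin n → ℝ) × (Fin n → ℝ)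

/-- Euclidean dot product on ℝⁿ. -/
def dot (x y : Rn n) : ℝ := ∑ i, x i * y i

/-- squared Euclidean norm on ℝⁿ. -/
def sq (x : Rn n) : ℝ := ∑ i, x i ^ 2

/-- squared Euclidean norm on phase space ℝ^{2n}. -/
def sq2 (z : Ph n) : ℝ := sq z.1 + sq z.2

/-- translation operator T_x. -/
def Tr (x : Rn n) (f : Rn n → ℂ) : Rn n → ℂ := fun t => f (t - x)

/-- modulation operator M_ξ. -/
def Mo (ξ : Rn n) (f : Rn n → ℂ) : Rn n → ℂ :=
  fun t => Complex.exp (2 * (Real.pi : ℂ) * Complex.I * ((dot ξ t : ℝ) : ℂ)) * f t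

/-- dilation operator D_λ. -/
def Dil (lam : ℝ) (f : Rn n → ℂ) : Rn n → ℂ :=
  fun x => ((lam ^ ((n : ℝ) / 2) : ℝ) : ℂ) * f (lam • x)

/-- Weyl–Heisenberg operator 𝒯̂^ħ(z). -/
def WH (hbar : ℝ) (z : Ph n) (f : Rn n → ℂ) : Rn n → ℂ :=
  fun x => Complex.exp (Complex.I * ((hbar⁻¹ * (dot z.2 x - dot z.1 z.2 / 2) : ℝ) : ℂ)) * f (x - z.1)

/-- 𝒯̂ = 𝒯̂^{1/(2π)}. -/
def T1 (z : Ph n) (f : Rn n → ℂ) : Rn n → ℂ := WH (1 / (2 * Real.pi)) z f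

/-- L² inner product ⟨f,g⟩ = ∫ f ⋅ conj g. -/
def l2inner (f g : Rn n → ℂ) : ℂ := ∫ t, f t * conj (g t)

/-- ‖f‖₂². -/
def l2normSq (f : Rn n → ℂ) : ℝ := ∫ t, ‖f t‖ ^ 2

/-- rescaled window g^h = D_{h^{-1/2}} g. -/
def gh (h : ℝ) (g : Rn n → ℂ) : Rn n → ℂ := Dil (Real.sqrt h)⁻¹ g

/-- coercion of integer lattice point. -/
def iC (k : Fin n → ℤ) : Rn n := fun i => (k i : ℝ)

/-- A and B are frame bounds for the system of atoms. -/
def FrameBounds {ι : Type} (A B : ℝ) (atom : ι → Rn n → ℂ) : Prop :=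
  ∀ f : Rn n → ℂ, MemLp f 2 volume →
    ENNReal.ofReal (A * l2normSq f) ≤ ∑' i, (‖l2inner f (atom i)‖₊ : ℝ≥0∞) ^ 2 ∧
    ∑' i, (‖l2inner f (atom i)‖₊ : ℝ≥0∞) ^ 2 ≤ ENNReal.ofReal (B * l2normSq f)

/-- the system of atoms is a frame for L²(ℝⁿ). -/
def IsFrame {ι : Type} (atom : ι → Rn n → ℂ) : Prop :=
  ∃ A B : ℝ, 0 < A ∧ A ≤ B ∧ FrameBounds A B atom

/-- Gabor atoms T_{αk} M_{βm} g, indexed by (k,m) ∈ ℤⁿ×ℤⁿ. -/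
def gaborAtom (α β : ℝ) (g : Rn n → ℂ) (km : (Fin n → ℤ) × (Fin n → ℤ)) : Rn n → ℂ :=
  Tr (α • iC km.1) (Mo (β • iC km.2) g)

/-- the standard Gaussian ψ₀. -/
def ψ₀ : Rn n → ℂ :=
  fun x => (((2 : ℝ) ^ ((n : ℝ) / 4) : ℝ) : ℂ) * Complex.exp ((-(Real.pi * sq x) : ℝ) : ℂ)




lemma summ_gauss {b : ℝ} (hb : 0 < b) (L : ℝ) :
    Summable fun m : ℤ => Real.exp (-b * (m : ℝ) ^ 2 + L * |(m : ℝ)|) := by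
  have h := summable_pow_mul_jacobiTheta₂_term_bound (L / (2 * Real.pi))
    (T := b / Real.pi) (by positivity) 0
  refine h.congr fun m => ?_
  have := Real.pi_pos
  simp only [pow_zero, one_mul, Int.cast_abs]
  congr 1
  field_simp
  ring

/-- Coefficients of Euler's q-exponential. -/
def eN (q : ℝ) : ℕ → ℝ
  | 0 => 1
  | m + 1 => -(q ^ (m + 1) / (1 - q ^ (m + 1))) * eN q m

/-- Extension by zero to the integers. -/
def eZ (b : ℝ) (m : ℤ) : ℝ := if m < 0 then 0 else eN (Real.exp (-2 * b)) m.toNat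

lemma eN_bound {b : ℝ} (hb : 0 < b) (m : ℕ) :
    |eN (Real.exp (-2 * b)) m| ≤
      Real.exp (-b * (m : ℝ) ^ 2 + (-Real.log (1 - Real.exp (-2 * b))) * m) := by
  have hq1 : Real.exp (-2 * b) < 1 := by rw [Real.exp_lt_one_iff]; linarith
  induction m with
  | zero => simp [eN]
  | succ m ih =>
    have hpow : Real.exp (-2 * b) ^ (m + 1) = Real.exp (-2 * b * (m + 1)) := by
      rw [← Real.exp_nat_mul]; congr 1; push_cast; ring
    have hle : Real.exp (-2 * b) ^ (m + 1) ≤ Real.exp (-2 * b) := by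
      calc _ ≤ Real.exp (-2 * b) ^ 1 :=
            pow_le_pow_of_le_one (Real.exp_pos _).le hq1.le (by omega)
        _ = _ := pow_one _
    rw [eN, abs_mul, abs_neg, abs_div, abs_of_pos (by positivity),
      abs_of_pos (by linarith : 0 < 1 - Real.exp (-2 * b) ^ (m + 1))]
    have e1 : Real.exp (-b * ((m + 1 : ℕ) : ℝ) ^ 2 + (-Real.log (1 - Real.exp (-2 * b))) * (m + 1 : ℕ))
        = (Real.exp (-b * (2 * m + 1)) / (1 - Real.exp (-2 * b))) *
         Real.exp (-b * (m : ℝ) ^ 2 + (-Real.log (1 - Real.exp (-2 * b))) * m) := by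
      have : (1 - Real.exp (-2 * b)) = Real.exp (Real.log (1 - Real.exp (-2 * b))) :=
        (Real.exp_log (by linarith)).symm
      conv_rhs => rw [this]
      rw [← Real.exp_sub, ← Real.exp_add, Real.exp_log (by linarith)]
      congr 1
      push_cast
      ring
    rw [e1]
    refine mul_le_mul ?_ ih (abs_nonneg _) (by
      have : 0 < 1 - Real.exp (-2 * b) := by linarith
      positivity)
    refine div_le_div₀ (Real.exp_pos _).le ?_ (by linarith) (by linarith)
    rw [hpow]
    apply Real.exp_le_exp.mpr
    nlinarith

lemma eZ_bound {b : ℝ} (hb : 0 < b) (m : ℤ) :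
    |eZ b m| ≤ Real.exp (-b * (m : ℝ) ^ 2 + (-Real.log (1 - Real.exp (-2 * b))) * |(m : ℝ)|) := by
  unfold eZ
  split_ifs with h
  · simp; positivity
  · have := eN_bound hb m.toNat
    have h2 : ((m.toNat : ℕ) : ℝ) = (m : ℝ) := by
      have : ((m.toNat : ℕ) : ℤ) = m := by omega
      exact_mod_cast congrArg (Int.cast : ℤ → ℝ) this
    rw [h2] at this
    rwa [abs_of_nonneg (by exact_mod_cast (not_lt.mp h) : (0 : ℝ) ≤ m)]

lemma eZ_rec {b : ℝ} (hb : 0 < b) (m : ℤ) :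
    eZ b m * (1 - Real.exp (-2 * b * m)) = - Real.exp (-2 * b * m) * eZ b (m - 1) := by
  have hq1 : Real.exp (-2 * b) < 1 := by rw [Real.exp_lt_one_iff]; linarith
  rcases lt_trichotomy m 0 with h | h | h
  · have : m - 1 < 0 := by omega
    simp [eZ, h, this]
  · subst h; simp [eZ]
  · obtain ⟨k, rfl⟩ : ∃ k : ℕ, m = k + 1 := ⟨(m - 1).toNat, by omega⟩
    have h1 : ¬ ((k : ℤ) + 1 < 0) := by omega
    have h2 : ¬ ((k : ℤ) + 1 - 1 < 0) := by omega
    simp only [eZ, h1, h2, if_false]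
    have h3 : ((k : ℤ) + 1).toNat = k + 1 := by omega
    have h4 : ((k : ℤ) + 1 - 1).toNat = k := by omega
    rw [h3, h4, eN]
    have hpow : Real.exp (-2 * b) ^ (k + 1) = Real.exp (-2 * b * ((k + 1 : ℤ) : ℝ)) := by
      rw [← Real.exp_nat_mul]; congr 1; push_cast; ring
    have hle : Real.exp (-2 * b) ^ (k + 1) ≤ Real.exp (-2 * b) := by
      calc _ ≤ Real.exp (-2 * b) ^ 1 :=
            pow_le_pow_of_le_one (Real.exp_pos _).le hq1.le (by omega)
        _ = _ := pow_one _
    rw [← hpow]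
    have hne : 1 - Real.exp (-2 * b) ^ (k + 1) ≠ 0 := by linarith
    generalize Real.exp (-2 * b) ^ (k + 1) = Q at *
    field_simp

lemma eZ_summ {b : ℝ} (hb : 0 < b) (r : ℝ) :
    Summable fun m : ℤ => |eZ b m * Real.exp (-2 * b * m * r)| := by
  refine Summable.of_nonneg_of_le (fun _ => abs_nonneg _) (fun m => ?_)
    (summ_gauss hb (-Real.log (1 - Real.exp (-2 * b)) + 2 * b * |r|))
  rw [abs_mul, abs_of_pos (Real.exp_pos _)]
  calc _ ≤ Real.exp (-b * (m : ℝ) ^ 2 + (-Real.log (1 - Real.exp (-2 * b))) * |(m : ℝ)|) *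
        Real.exp (2 * b * (|(m : ℝ)| * |r|)) := by
        refine mul_le_mul (eZ_bound hb m) ?_ (Real.exp_pos _).le (Real.exp_pos _).le
        apply Real.exp_le_exp.mpr
        have := neg_abs_le ((m : ℝ) * r)
        rw [abs_mul] at this
        nlinarith
    _ = _ := by rw [← Real.exp_add]; congr 1; ring

/-- Euler's function at `q ^ r`. -/
def Ev (b : ℝ) (r : ℤ) : ℝ := ∑' m : ℤ, eZ b m * Real.exp (-2 * b * m * r)

lemma Ev_rec {b : ℝ} (hb : 0 < b) (r : ℤ) :
    Ev b r = (1 - Real.exp (-2 * b * (r + 1))) * Ev b (r + 1) := by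
  have s0 := (eZ_summ hb r).of_abs
  have s1 := (eZ_summ hb ((r + 1 : ℤ) : ℝ)).of_abs
  have h1 : Ev b r - Ev b (r + 1) = - Real.exp (-2 * b * (r + 1)) * Ev b (r + 1) := by
    unfold Ev
    rw [← s0.tsum_sub s1, ← tsum_mul_left,
      ← (Equiv.addRight (1 : ℤ)).tsum_eq]
    congr 1
    ext m
    have h := eZ_rec hb (m + 1)
    rw [add_sub_cancel_right] at h
    simp only [Equiv.coe_addRight]
    have e1 : Real.exp (-2 * b * ((m + 1 : ℤ) : ℝ) * ((r + 1 : ℤ) : ℝ)) =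
        Real.exp (-2 * b * ((m + 1 : ℤ) : ℝ)) * Real.exp (-2 * b * ((m + 1 : ℤ) : ℝ) * r) := by
      rw [← Real.exp_add]; congr 1; push_cast; ring
    have e2 : Real.exp (-2 * b * (r + 1)) * Real.exp (-2 * b * m * ((r + 1 : ℤ) : ℝ)) =
        Real.exp (-2 * b * ((m + 1 : ℤ) : ℝ)) * Real.exp (-2 * b * ((m + 1 : ℤ) : ℝ) * r) := by
      rw [← Real.exp_add, ← Real.exp_add]; congr 1; push_cast; ring
    rw [e1]
    linear_combination Real.exp (-2 * b * ((m + 1 : ℤ) : ℝ) * r) * h + eZ b m * e2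
  linear_combination h1

lemma Ev_neg {b : ℝ} (hb : 0 < b) (k : ℕ) : Ev b (-1 - k) = 0 := by
  induction k with
  | zero =>
    rw [Ev_rec hb]; simp
  | succ k ih =>
    rw [Ev_rec hb]
    have : (-1 - ((k + 1 : ℕ) : ℤ) + 1) = -1 - (k : ℤ) := by push_cast; ring
    rw [this, ih, mul_zero]

lemma Ev_zero {b : ℝ} (hb : 0 < b) : Ev b 0 ≠ 0 := by
  intro h0
  have hz : ∀ k : ℕ, Ev b k = 0 := by
    intro k
    induction k with
    | zero => simpa using h0
    | succ k ih =>
      rw [Ev_rec hb] at ih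
      have : 1 - Real.exp (-2 * b * (((k : ℕ) : ℤ) + 1)) ≠ 0 := by
        have : Real.exp (-2 * b * (((k : ℕ) : ℤ) + 1)) < 1 := by
          rw [Real.exp_lt_one_iff]; push_cast
          have : (0 : ℝ) ≤ k := by positivity
          nlinarith
        push_cast at this ⊢
        linarith
      have := (mul_eq_zero.mp ih).resolve_left this
      exact_mod_cast this
  have s0 : Summable fun m : ℤ => |eZ b m| := by simpa using eZ_summ hb 0
  have key : ∀ k : ℕ, 1 ≤ Real.exp (-2 * b) ^ k * ∑' m : ℤ, |eZ b m| := by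
    intro k
    have s1 := (eZ_summ hb (k : ℝ)).of_abs
    have hs : HasSum (fun m : ℤ => if m = 0 then (1 : ℝ) else 0) 1 := hasSum_ite_eq 0 1
    have h1 : HasSum (fun m : ℤ => (if m = 0 then (1 : ℝ) else 0) -
        eZ b m * Real.exp (-2 * b * m * k)) (1 - 0) := by
      refine hs.sub ?_
      have := s1.hasSum
      have h := hz k
      unfold Ev at h
      push_cast at h
      rwa [h] at this
    have h2 := s0.hasSum.mul_left (Real.exp (-2 * b) ^ k)
    have := hasSum_le (fun m => ?_) h1 h2
    · simpa using this
    · have hpk : Real.exp (-2 * b) ^ k = Real.exp (-2 * b * k) := by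
        rw [← Real.exp_nat_mul]; congr 1; ring
      split_ifs with hm
      · subst hm
        simp [eZ, eN]
        positivity
      · rw [zero_sub]
        refine (neg_le_abs _).trans ?_
        rw [abs_mul, abs_of_pos (Real.exp_pos _), mul_comm]
        rcases lt_or_ge m 0 with h | h
        · simp [eZ, h]
        · refine mul_le_mul_of_nonneg_right ?_ (abs_nonneg _)
          rw [hpk]
          apply Real.exp_le_exp.mpr
          have hm1 : (1 : ℝ) ≤ m := by exact_mod_cast (by omega : 1 ≤ m)
          have hk : (0 : ℝ) ≤ k := by positivity
          have : (k : ℝ) ≤ m * k := by nlinarith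
          nlinarith
  have hlim : Tendsto (fun k : ℕ => Real.exp (-2 * b) ^ k * ∑' m : ℤ, |eZ b m|) atTop
      (nhds (0 * ∑' m : ℤ, |eZ b m|)) := by
    refine (tendsto_pow_atTop_nhds_zero_of_lt_one (Real.exp_pos _).le ?_).mul_const _
    rw [Real.exp_lt_one_iff]; linarith
  have := ge_of_tendsto' hlim key
  rw [zero_mul] at this
  linarith

/-- The dual coefficients. -/
def aC (b : ℝ) (j : ℤ) : ℝ := ∑' p : ℤ, eZ b (p + j) * eZ b p

lemma aC_hasSum {b : ℝ} (hb : 0 < b) (r : ℤ) :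
    HasSum (fun j : ℤ => aC b j * Real.exp (-2 * b * j * r)) (Ev b r * Ev b (-r)) := by
  have s0 := eZ_summ hb (r : ℝ)
  have s1 := eZ_summ hb ((-r : ℤ) : ℝ)
  have n0 : Summable fun m : ℤ => ‖eZ b m * Real.exp (-2 * b * m * (r : ℝ))‖ := s0
  have n1 : Summable fun m : ℤ => ‖eZ b m * Real.exp (-2 * b * m * ((-r : ℤ) : ℝ))‖ := s1
  have hs := (s0.of_abs.hasSum.mul s1.of_abs.hasSum (summable_mul_of_summable_norm n0 n1))
  let φ : ℤ × ℤ ≃ ℤ × ℤ :=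
    { toFun := fun x => (x.2 + x.1, x.2)
      invFun := fun x => (x.1 - x.2, x.2)
      left_inv := fun x => by simp
      right_inv := fun x => by simp }
  have h2 := (φ.hasSum_iff).mpr hs
  have hsum2 := h2.summable
  have h3 := h2.prod_fiberwise (fun j => (hsum2.prod_factor j).hasSum)
  refine (congrArg (fun u : ℤ → ℝ => HasSum u (Ev b r * Ev b (-r))) (funext fun j => ?_)).mpr h3
  simp only [Function.comp, φ, Equiv.coe_fn_mk]
  rw [aC, ← tsum_mul_right]
  congr 1
  ext p
  have : Real.exp (-2 * b * j * r) = Real.exp (-2 * b * ((p + j : ℤ) : ℝ) * r) *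
      Real.exp (-2 * b * p * ((-r : ℤ) : ℝ)) := by
    rw [← Real.exp_add]; congr 1; push_cast; ring
  rw [this]
  ring

lemma aC_hasSum' {b : ℝ} (hb : 0 < b) (r : ℤ) :
    HasSum (fun j : ℤ => aC b j / (Ev b 0) ^ 2 * Real.exp (-2 * b * j * r))
      (if r = 0 then 1 else 0) := by
  have h := (aC_hasSum hb r).mul_left (1 / (Ev b 0) ^ 2)
  have hz := Ev_zero hb
  have e1 : (fun j : ℤ => aC b j / (Ev b 0) ^ 2 * Real.exp (-2 * b * j * r)) =
      fun j : ℤ => 1 / (Ev b 0) ^ 2 * (aC b j * Real.exp (-2 * b * j * r)) := by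
    funext j; ring
  have e2 : (if r = 0 then (1 : ℝ) else 0) = 1 / (Ev b 0) ^ 2 * (Ev b r * Ev b (-r)) := ?_
  · rw [e1, e2]; exact h
  · split_ifs with hr
    · subst hr; rw [neg_zero]; field_simp
    · have : Ev b r * Ev b (-r) = 0 := by
        rcases lt_or_gt_of_ne hr with h | h
        · have := Ev_neg hb (-1 - r).toNat
          rw [show -1 - (((-1 - r).toNat : ℕ) : ℤ) = r by omega] at this
          rw [this, zero_mul]
        · have := Ev_neg hb (r - 1).toNat
          rw [show -1 - (((r - 1).toNat : ℕ) : ℤ) = -r by omega] at this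
          rw [this, mul_zero]
      rw [this, mul_zero]

lemma aC_neg (b : ℝ) (j : ℤ) : aC b (-j) = aC b j := by
  unfold aC
  rw [← (Equiv.addRight j).tsum_eq]
  congr 1
  ext p
  simp only [Equiv.coe_addRight]
  rw [add_neg_cancel_right, mul_comm]

lemma aC_bound {b : ℝ} (hb : 0 < b) : ∃ C L : ℝ, 0 ≤ C ∧ 0 ≤ L ∧ ∀ j : ℤ,
    |aC b j| ≤ C * Real.exp (-b * (j : ℝ) ^ 2 + L * |(j : ℝ)|) := by
  set L := -Real.log (1 - Real.exp (-2 * b)) with hL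
  have hL0 : 0 ≤ L := by
    have : Real.log (1 - Real.exp (-2 * b)) ≤ 0 := by
      apply Real.log_nonpos
      · have : Real.exp (-2 * b) < 1 := by rw [Real.exp_lt_one_iff]; linarith
        linarith
      · linarith [Real.exp_pos (-2 * b)]
    linarith
  have hS := summ_gauss hb (2 * L)
  refine ⟨∑' p : ℤ, Real.exp (-b * (p : ℝ) ^ 2 + 2 * L * |(p : ℝ)|), L,
    tsum_nonneg fun _ => (Real.exp_pos _).le, hL0, ?_⟩
  have hpos : ∀ j : ℤ, 0 ≤ j → |aC b j| ≤
      (∑' p : ℤ, Real.exp (-b * (p : ℝ) ^ 2 + 2 * L * |(p : ℝ)|)) *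
        Real.exp (-b * (j : ℝ) ^ 2 + L * |(j : ℝ)|) := by
    intro j hj
    rw [← tsum_mul_right]
    unfold aC
    rw [← Real.norm_eq_abs]
    refine tsum_of_norm_bounded (hS.mul_right _).hasSum (fun p => ?_)
    rw [Real.norm_eq_abs, abs_mul]
    rcases lt_or_ge p 0 with hp | hp
    · simp [eZ, hp]; positivity
    · refine (mul_le_mul (eZ_bound hb (p + j)) (eZ_bound hb p) (abs_nonneg _)
        (Real.exp_pos _).le).trans ?_
      rw [← hL, ← Real.exp_add, ← Real.exp_add]
      apply Real.exp_le_exp.mpr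
      have hp' : (0 : ℝ) ≤ p := by exact_mod_cast hp
      have hj' : (0 : ℝ) ≤ j := by exact_mod_cast hj
      push_cast
      rw [abs_of_nonneg hp', abs_of_nonneg hj', abs_of_nonneg (add_nonneg hp' hj')]
      nlinarith [mul_nonneg hb.le (mul_nonneg hp' hj'), mul_nonneg hb.le (mul_nonneg hp' hp')]
  intro j
  rcases le_total 0 j with h | h
  · exact hpos j h
  · have := hpos (-j) (by omega)
    rw [aC_neg] at this
    simpa using this

lemma exists_dual {a ρ : ℝ} (ha : 0 < a) (hρ : 0 < ρ) (hρ1 : ρ < 1) :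
    ∃ (γ : ℝ → ℝ) (C a' : ℝ), 0 ≤ C ∧ 0 < a' ∧ (∀ u, |γ u| ≤ C * Real.exp (-a' * u ^ 2)) ∧
      ∀ (y : ℝ) (r : ℤ), HasSum
        (fun k : ℤ => γ (y - ρ * k) * Real.exp (-a * (y - ρ * k + r) ^ 2))
        (if r = 0 then 1 else 0) := by
  have hb : 0 < a * ρ := mul_pos ha hρ
  obtain ⟨C, L, hC, hL, hbd⟩ := aC_bound hb
  set E := (Ev (a * ρ) 0) ^ 2 with hE
  have hEpos : 0 < E := by
    have := Ev_zero hb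
    positivity
  set a' := a * (1 - ρ) / (2 * ρ) with ha'
  have ha'pos : 0 < a' := by
    have : 0 < 1 - ρ := by linarith
    positivity
  set κ := a * ρ * (1 - ρ) / 2 with hκ
  have hκpos : 0 < κ := by
    have : 0 < 1 - ρ := by linarith
    positivity
  have hrel : (a + a') * ρ ^ 2 - a * ρ = -κ := by
    rw [ha', hκ]; field_simp; ring
  set M := 2 * (a + a') * ρ ^ 2 + L with hM
  refine ⟨fun u => Real.exp (a * u ^ 2) * (aC (a * ρ) ⌊u / ρ⌋ / E),
    C / E * Real.exp (M ^ 2 / (4 * κ) + (a + a') * ρ ^ 2), a', by positivity, ha'pos, ?_, ?_⟩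
  · intro u
    set N := ⌊u / ρ⌋ with hN
    have h1 : (N : ℝ) * ρ ≤ u := by
      have := Int.floor_le (u / ρ)
      rwa [le_div_iff₀ hρ] at this
    have h2 : u ≤ (N : ℝ) * ρ + ρ := by
      have := (Int.lt_floor_add_one (u / ρ)).le
      rw [div_le_iff₀ hρ] at this
      linarith
    have hu : |u| ≤ ρ * |(N : ℝ)| + ρ := by
      rw [abs_le]
      constructor
      · nlinarith [neg_abs_le (N : ℝ)]
      · nlinarith [le_abs_self (N : ℝ)]
    have hu2 : u ^ 2 ≤ ρ ^ 2 * (N : ℝ) ^ 2 + 2 * ρ ^ 2 * |(N : ℝ)| + ρ ^ 2 := by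
      have := pow_le_pow_left₀ (abs_nonneg u) hu 2
      rw [sq_abs] at this
      nlinarith [sq_abs (N : ℝ)]
    rw [abs_mul, abs_of_pos (Real.exp_pos _), abs_div, abs_of_pos hEpos]
    calc _ ≤ Real.exp (a * u ^ 2) *
          (C * Real.exp (-(a * ρ) * (N : ℝ) ^ 2 + L * |(N : ℝ)|) / E) := by
          have := hbd N
          gcongr
      _ = C / E * Real.exp (a * u ^ 2 + (-(a * ρ) * (N : ℝ) ^ 2 + L * |(N : ℝ)|)) := by
          rw [Real.exp_add (a * u ^ 2)]; ring
      _ ≤ C / E * Real.exp (M ^ 2 / (4 * κ) + (a + a') * ρ ^ 2 + -a' * u ^ 2) := by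
          have : a * u ^ 2 + (-(a * ρ) * (N : ℝ) ^ 2 + L * |(N : ℝ)|) ≤
              M ^ 2 / (4 * κ) + (a + a') * ρ ^ 2 + -a' * u ^ 2 := by
            have h3 : (a + a') * u ^ 2 ≤
                (a + a') * (ρ ^ 2 * (N : ℝ) ^ 2 + 2 * ρ ^ 2 * |(N : ℝ)| + ρ ^ 2) := by
              gcongr
            have h4 : 0 ≤ κ * (|(N : ℝ)| - M / (2 * κ)) ^ 2 := by positivity
            have h5 : κ * (|(N : ℝ)| - M / (2 * κ)) ^ 2 =
                κ * (N : ℝ) ^ 2 - M * |(N : ℝ)| + M ^ 2 / (4 * κ) := by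
              rw [← sq_abs (N : ℝ)]; field_simp; ring
            have h6 : (a + a') * (ρ ^ 2 * (N : ℝ) ^ 2) = (a * ρ - κ) * (N : ℝ) ^ 2 := by
              linear_combination (N : ℝ) ^ 2 * hrel
            nlinarith
          gcongr
      _ = _ := by rw [Real.exp_add]; ring
  · intro y r
    set N := ⌊y / ρ⌋ with hN
    have h := (aC_hasSum' hb (-r)).mul_left
      (Real.exp (-2 * a * (y - ρ * N) * r - a * r ^ 2))
    have h' := ((Equiv.subRight N).hasSum_iff).mpr h
    have e2 : (if r = 0 then (1 : ℝ) else 0) =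
        Real.exp (-2 * a * (y - ρ * N) * r - a * r ^ 2) * (if -r = 0 then 1 else 0) := by
      by_cases hr : r = 0
      · subst hr; simp
      · simp [hr]
    rw [e2]
    refine (congrArg (fun u : ℤ → ℝ => HasSum u _) (funext fun k => ?_)).mpr h'
    simp only [Function.comp, Equiv.subRight_apply]
    have hf : ⌊(y - ρ * k) / ρ⌋ = N - k := by
      rw [sub_div, mul_div_cancel_left₀ _ hρ.ne', Int.floor_sub_intCast]
    rw [hf, ← aC_neg, neg_sub, ← hE]
    have : Real.exp (a * (y - ρ * k) ^ 2) * Real.exp (-a * (y - ρ * k + r) ^ 2) =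
      Real.exp (-2 * a * (y - ρ * N) * r - a * r ^ 2) *
        Real.exp (-2 * (a * ρ) * ((k - N : ℤ) : ℝ) * ((-r : ℤ) : ℝ)) := by
      rw [← Real.exp_add, ← Real.exp_add]; congr 1; push_cast; ring
    linear_combination aC (a * ρ) (k - N) / E * this

lemma gauss_unif {c ρ : ℝ} (hc : 0 < c) (hρ : 0 < ρ) : ∃ C : ℝ≥0∞, C ≠ ⊤ ∧ ∀ y : ℝ,
    ∑' k : ℤ, ENNReal.ofReal (Real.exp (-c * (y - ρ * k) ^ 2)) ≤ C := by
  have hs := summ_gauss (b := c * ρ ^ 2) (by positivity) (2 * c * ρ ^ 2)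
  refine ⟨_, hs.tsum_ofReal_ne_top, fun y => ?_⟩
  set N := ⌊y / ρ⌋ with hN
  have h1 : (N : ℝ) * ρ ≤ y := by
    have := Int.floor_le (y / ρ)
    rwa [le_div_iff₀ hρ] at this
  have h2 : y ≤ (N : ℝ) * ρ + ρ := by
    have := (Int.lt_floor_add_one (y / ρ)).le
    rw [div_le_iff₀ hρ] at this
    linarith
  rw [← (Equiv.addRight N).tsum_eq]
  refine ENNReal.tsum_le_tsum fun j => ENNReal.ofReal_le_ofReal (Real.exp_le_exp.mpr ?_)
  simp only [Equiv.coe_addRight]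
  push_cast
  set x := y - ρ * N with hx
  have hx0 : 0 ≤ x := by rw [hx]; linarith
  have hx1 : x ≤ ρ := by rw [hx]; linarith
  have e : y - ρ * (j + N) = x - ρ * j := by rw [hx]; ring
  rw [e]
  have h3 : x * j ≤ ρ * |(j : ℝ)| := by
    calc x * j ≤ x * |(j : ℝ)| := mul_le_mul_of_nonneg_left (le_abs_self _) hx0
      _ ≤ _ := mul_le_mul_of_nonneg_right hx1 (abs_nonneg _)
  have h4 := mul_le_mul_of_nonneg_left h3 (by positivity : 0 ≤ 2 * c * ρ)
  nlinarith [mul_nonneg hc.le (sq_nonneg x)]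

lemma gauss_unif' {c : ℝ} (hc : 0 < c) : ∃ C : ℝ≥0∞, C ≠ ⊤ ∧ ∀ y : ℝ,
    ∑' k : ℤ, ENNReal.ofReal (Real.exp (-c * (y + k) ^ 2)) ≤ C := by
  obtain ⟨C, hC, h⟩ := gauss_unif hc one_pos
  refine ⟨C, hC, fun y => ?_⟩
  refine le_trans (le_of_eq ?_) (h y)
  rw [← (Equiv.neg ℤ).tsum_eq]
  congr 1
  ext k
  simp [sub_eq_add_neg]

/-- sign `(-1)^l` -/
def sg (l : ℤ) : ℝ := (((-1 : ℤˣ) ^ l : ℤˣ) : ℤ)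

lemma sg_abs (l : ℤ) : |sg l| = 1 := by
  unfold sg
  rcases Int.units_eq_one_or ((-1 : ℤˣ) ^ l) with h | h <;> simp [h]

lemma sg_flip (k l : ℤ) : sg (2 * k - 1 - l) = - sg l := by
  unfold sg
  have : ((-1 : ℤˣ)) ^ (2 * k - 1 - l) = - (-1 : ℤˣ) ^ l := by
    rcases Int.even_or_odd l with h | h
    · have h2 : Odd (2 * k - 1 - l) := by
        obtain ⟨m, rfl⟩ := h; exact ⟨k - 1 - m, by ring⟩
      rw [h.neg_one_zpow, h2.neg_one_zpow]
    · have h2 : Even (2 * k - 1 - l) := by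
        obtain ⟨m, rfl⟩ := h; exact ⟨k - 1 - m, by ring⟩
      rw [h.neg_one_zpow, h2.neg_one_zpow]; simp
  rw [this]; simp

lemma theta_zero (a ρ s : ℝ) (k : ℤ) :
    ∑' l : ℤ, (sg l * Real.exp (a * (s + l) ^ 2 - a * ρ * (l * (l + 1)))) *
      Real.exp (-a * (s + l - ρ * k) ^ 2) = 0 := by
  set T : ℤ → ℝ := fun l => (sg l * Real.exp (a * (s + l) ^ 2 - a * ρ * (l * (l + 1)))) *
      Real.exp (-a * (s + l - ρ * k) ^ 2) with hT
  have h : ∀ l, T (2 * k - 1 - l) = - T l := by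
    intro l
    simp only [hT]
    rw [sg_flip, mul_assoc (-sg l), mul_assoc (sg l), ← Real.exp_add, ← Real.exp_add, neg_mul]
    congr 3
    push_cast
    ring
  have h2 : ∑' l, T l = - ∑' l, T l := by
    conv_lhs => rw [← (Equiv.subLeft (2 * k - 1)).tsum_eq]
    rw [← tsum_neg]
    congr 1
    ext l
    exact h l
  linarith

lemma abs_exp_sub_one (h : ℝ) : |Real.exp h - 1| ≤ |h| * Real.exp |h| := by
  have h1 : 1 ≤ Real.exp |h| := Real.one_le_exp (abs_nonneg h)
  rcases le_total 0 h with hh | hh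
  · rw [abs_of_nonneg hh, abs_of_nonneg (by linarith [Real.one_le_exp hh])]
    have := Real.add_one_le_exp (-h)
    have h2 : Real.exp (-h) * Real.exp h = 1 := by rw [← Real.exp_add]; simp
    nlinarith [Real.exp_pos h]
  · have := Real.add_one_le_exp h
    rw [abs_of_nonpos (by linarith [Real.exp_le_one_iff.mpr hh])]
    rw [abs_of_nonpos hh] at h1 ⊢
    nlinarith

set_option maxHeartbeats 2000000 in
/-- Existence of approximate kernel vectors for `ρ ≥ 1`. -/
lemma exists_approx_kernel {a ρ ε : ℝ} (ha : 0 < a) (hρ : 1 ≤ ρ) (hε : 0 < ε) :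
    ∃ (φ : ℝ → ℤ → ℝ) (u v : ℝ) (D : ℤ → ℝ), 0 ≤ u ∧ u < v ∧ v ≤ 1 ∧ Summable D ∧
      (∀ l, Continuous fun s => φ s l) ∧
      ∀ s ∈ Set.Ioc u v, φ s 0 ≠ 0 ∧ (∀ l, |φ s l| ≤ D l) ∧
        ∑' k : ℤ, ENNReal.ofReal
          ((∑' l : ℤ, φ s l * Real.exp (-a * (s + l - ρ * k) ^ 2)) ^ 2) ≤
        ENNReal.ofReal ε * ∑' l : ℤ, ENNReal.ofReal (φ s l ^ 2) := by
  rcases hρ.lt_or_eq with hρ | hρ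
  · have hs := (summ_gauss (b := a * (ρ - 1)) (mul_pos ha (by linarith))
      (2 * a + ρ * a)).mul_left (Real.exp a)
    refine ⟨fun s l => sg l * Real.exp (a * (s + l) ^ 2 - a * ρ * (l * (l + 1))), 0, 1, _,
      le_rfl, one_pos, le_rfl, hs, fun l => by fun_prop, fun s hs => ⟨?_, ?_, ?_⟩⟩
    · have := sg_abs 0
      have h0 : sg 0 ≠ 0 := by intro h; rw [h] at this; simp at this
      positivity
    · intro l
      rw [abs_mul, sg_abs, one_mul, abs_of_pos (Real.exp_pos _), ← Real.exp_add]
      apply Real.exp_le_exp.mpr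
      have hs0 := hs.1.le
      have hs1 := hs.2
      have h1 : s * l ≤ |(l : ℝ)| := by
        calc s * l ≤ s * |(l : ℝ)| := mul_le_mul_of_nonneg_left (le_abs_self _) hs0
          _ ≤ 1 * |(l : ℝ)| := mul_le_mul_of_nonneg_right hs1 (abs_nonneg _)
          _ = _ := one_mul _
      have h2 : s ^ 2 ≤ 1 := by nlinarith
      have h3 := mul_le_mul_of_nonneg_left h1 ha.le
      have h4 := mul_le_mul_of_nonneg_left h2 ha.le
      have h5 := mul_le_mul_of_nonneg_left (neg_abs_le (l : ℝ))
        (by positivity : 0 ≤ a * ρ)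
      nlinarith
    · simp only [theta_zero]
      simp
  · subst hρ
    set M := ∑' j : ℤ, Real.exp (-a * (j : ℝ) ^ 2 + (3 + 2 * a) * |(j : ℝ)|) with hM
    have hMs := summ_gauss ha (3 + 2 * a)
    have hM0 : 0 ≤ M := tsum_nonneg fun _ => (Real.exp_pos _).le
    set η := min 1 (ε / (M ^ 2 + 1)) with hη
    have hη0 : 0 < η := by positivity
    have hη1 : η ≤ 1 := min_le_left _ _
    have hηM : η ^ 2 * M ^ 2 ≤ ε := by
      have h1 : η ≤ ε / (M ^ 2 + 1) := min_le_right _ _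
      rw [le_div_iff₀ (by positivity)] at h1
      have h2 : η ^ 2 ≤ η := by nlinarith
      nlinarith [mul_le_mul_of_nonneg_right h2 (sq_nonneg M)]
    have hw : Summable fun l : ℤ => Real.exp (-(η / 2) * |(l : ℝ)|) := by
      have : Summable fun n : ℕ => Real.exp (-(η / 2) * (n : ℝ)) := by
        have := Real.summable_exp_nat_mul_iff.mpr (by linarith : -(η / 2) < 0)
        refine this.congr fun n => ?_
        rw [mul_comm]
      apply Summable.of_nat_of_neg <;> simpa using this
    set w : ℤ → ℝ := fun l => Real.exp (-(η / 2) * |(l : ℝ)|) with hwdef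
    set v := 1 / 2 + min (1 / 2) (η / (4 * a)) with hv
    have hv1 : v ≤ 1 := by
      have := min_le_left (1 / 2 : ℝ) (η / (4 * a)); linarith
    have hv0 : 1 / 2 < v := by
      have : 0 < min (1 / 2 : ℝ) (η / (4 * a)) := by positivity
      linarith
    refine ⟨fun s l => sg l * w l, 1 / 2, v, w, by norm_num, hv0, hv1, hw,
      fun l => by fun_prop, fun s hs => ⟨?_, ?_, ?_⟩⟩
    · have := sg_abs 0
      have h0 : sg 0 ≠ 0 := by intro h; rw [h] at this; simp at this
      have : w 0 ≠ 0 := (Real.exp_pos _).ne'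
      positivity
    · intro l
      rw [abs_mul, sg_abs, one_mul, abs_of_pos (Real.exp_pos _)]
    · set σ := s - 1 / 2 with hσ
      have hσ0 : 0 ≤ σ := by have := hs.1; rw [hσ]; linarith
      have hσ1 : 2 * a * σ ≤ η / 2 := by
        have h1 : σ ≤ η / (4 * a) := by
          have := hs.2
          have h2 := min_le_right (1 / 2 : ℝ) (η / (4 * a))
          rw [hσ]; linarith
        rw [le_div_iff₀ (by positivity)] at h1
        nlinarith
      have hs0 : 0 ≤ s := by rw [hσ] at hσ0; linarith
      have hs1 : s ≤ 1 := hs.2.trans hv1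
      -- pointwise bound
      have hP : ∀ k : ℤ, |∑' l : ℤ, sg l * w l * Real.exp (-a * (s + l - 1 * k) ^ 2)| ≤
          η * M * w k := by
        intro k
        have hz := theta_zero a 1 s k
        set B : ℤ → ℝ := fun l => sg l * Real.exp (a * (s + l) ^ 2 - a * 1 * (l * (l + 1))) *
          Real.exp (-a * (s + l - 1 * k) ^ 2) with hB
        set W : ℝ := Real.exp (-a * s ^ 2 - 2 * a * k * σ) * w k with hW
        -- domination
        have hgb : ∀ l : ℤ, Real.exp (-a * (s + l - 1 * k) ^ 2) ≤
            Real.exp (-a * ((l - k : ℤ) : ℝ) ^ 2 + (2 * a) * |((l - k : ℤ) : ℝ)|) := by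
          intro l
          apply Real.exp_le_exp.mpr
          push_cast
          set j := (l : ℝ) - k with hj
          have e : s + l - 1 * k = s + j := by rw [hj]; ring
          rw [e]
          have h1 : -(s * j) ≤ |j| := by
            calc -(s * j) = s * (-j) := by ring
              _ ≤ s * |j| := mul_le_mul_of_nonneg_left (neg_le_abs _) hs0
              _ ≤ 1 * |j| := mul_le_mul_of_nonneg_right hs1 (abs_nonneg _)
              _ = _ := one_mul _
          have h3 := mul_le_mul_of_nonneg_left h1 ha.le
          nlinarith [mul_nonneg ha.le (sq_nonneg s)]
        have hMk : Summable fun l : ℤ =>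
            Real.exp (-a * ((l - k : ℤ) : ℝ) ^ 2 + (3 + 2 * a) * |((l - k : ℤ) : ℝ)|) :=
          ((Equiv.subRight k).summable_iff).mpr hMs
        have hMk' : ∑' l : ℤ,
            Real.exp (-a * ((l - k : ℤ) : ℝ) ^ 2 + (3 + 2 * a) * |((l - k : ℤ) : ℝ)|) = M :=
          (Equiv.subRight k).tsum_eq
            (fun j : ℤ => Real.exp (-a * (j : ℝ) ^ 2 + (3 + 2 * a) * |(j : ℝ)|))
        have hBsum : Summable B := by
          refine Summable.of_norm_bounded (hMk.mul_left (Real.exp (a * s ^ 2 + 2 * a * k * σ)))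
            (fun l => ?_)
          rw [Real.norm_eq_abs, hB]
          simp only
          rw [abs_mul, abs_mul, sg_abs, one_mul, abs_of_pos (Real.exp_pos _),
            abs_of_pos (Real.exp_pos _)]
          refine (mul_le_mul_of_nonneg_left (hgb l) (Real.exp_pos _).le).trans ?_
          rw [← Real.exp_add, ← Real.exp_add]
          apply Real.exp_le_exp.mpr
          push_cast
          set j := (l : ℝ) - k with hj
          have e : (l : ℝ) = j + k := by rw [hj]; ring
          rw [e]
          have es : s = σ + 1 / 2 := by rw [hσ]; ring
          have h1 : 2 * a * σ * j ≤ 3 * |j| := by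
            calc 2 * a * σ * j ≤ 2 * a * σ * |j| :=
                  mul_le_mul_of_nonneg_left (le_abs_self _) (by positivity)
              _ ≤ 3 * |j| := mul_le_mul_of_nonneg_right (by linarith) (abs_nonneg _)
          have : a * (s + (j + k)) ^ 2 - a * 1 * ((j + k) * (j + k + 1)) =
            a * s ^ 2 + 2 * a * k * σ + 2 * a * σ * j := by rw [es]; ring
          rw [this]
          linarith
        have hkey : ∀ l : ℤ, |sg l * w l * Real.exp (-a * (s + l - 1 * k) ^ 2) - W * B l| ≤
            η * w k *
            Real.exp (-a * ((l - k : ℤ) : ℝ) ^ 2 + (3 + 2 * a) * |((l - k : ℤ) : ℝ)|) := by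
          intro l
          set h : ℝ := -(η / 2) * |(k : ℝ)| + (η / 2) * |(l : ℝ)| + 2 * a * σ * (l - k) with hh
          have e1 : W * B l = sg l * Real.exp (-a * (s + l - 1 * k) ^ 2) * (w l * Real.exp h) := by
            simp only [hW, hB, hwdef, hh]
            have : Real.exp (-a * s ^ 2 - 2 * a * k * σ) * Real.exp (-(η / 2) * |(k : ℝ)|) *
                Real.exp (a * (s + l) ^ 2 - a * 1 * (l * (l + 1))) =
                Real.exp (-(η / 2) * |(l : ℝ)|) *
                Real.exp (-(η / 2) * |(k : ℝ)| + (η / 2) * |(l : ℝ)| + 2 * a * σ * (l - k)) := by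
              rw [← Real.exp_add, ← Real.exp_add, ← Real.exp_add]
              congr 1
              rw [hσ]; ring
            linear_combination sg l * Real.exp (-a * (s + l - 1 * k) ^ 2) * this
          have e2 : sg l * w l * Real.exp (-a * (s + l - 1 * k) ^ 2) - W * B l =
              - (sg l * Real.exp (-a * (s + l - 1 * k) ^ 2) * w l * (Real.exp h - 1)) := by
            rw [e1]; ring
          rw [e2, abs_neg, abs_mul, abs_mul, abs_mul, sg_abs, one_mul,
            abs_of_pos (Real.exp_pos _), abs_of_pos (Real.exp_pos _ : 0 < w l)]
          have hlk : |(|(l : ℝ)| - |(k : ℝ)|)| ≤ |(l : ℝ) - k| := abs_abs_sub_abs_le_abs_sub _ _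
          have hhb : |h| ≤ η * |((l - k : ℤ) : ℝ)| := by
            push_cast
            have : h = (η / 2) * (|(l : ℝ)| - |(k : ℝ)|) + 2 * a * σ * (l - k) := by
              rw [hh]; ring
            rw [this]
            refine (abs_add_le _ _).trans ?_
            rw [abs_mul, abs_mul, abs_of_pos (by positivity : 0 < η / 2),
              abs_of_nonneg (by positivity : 0 ≤ 2 * a * σ)]
            have := mul_le_mul_of_nonneg_left hlk (by positivity : 0 ≤ η / 2)
            have := mul_le_mul_of_nonneg_right hσ1 (abs_nonneg ((l : ℝ) - k))
            linarith
          set J := |((l - k : ℤ) : ℝ)| with hJ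
          have hJ0 : 0 ≤ J := abs_nonneg _
          have hηJ : η * J ≤ J := by nlinarith
          have b1 : |Real.exp h - 1| ≤ η * J * Real.exp J := by
            refine (abs_exp_sub_one h).trans ?_
            refine mul_le_mul hhb (Real.exp_le_exp.mpr (hhb.trans hηJ)) (Real.exp_pos _).le
              (by positivity)
          have b2 : w l ≤ w k * Real.exp J := by
            simp only [hwdef]
            rw [← Real.exp_add]
            apply Real.exp_le_exp.mpr
            have h1 := (abs_le.mp hlk).1
            have h2 : |(l : ℝ) - k| = J := by rw [hJ]; push_cast; rfl
            rw [h2] at h1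
            nlinarith
          have b3 : J ≤ Real.exp J := by linarith [Real.add_one_le_exp J]
          calc Real.exp (-a * (s + l - 1 * k) ^ 2) * w l * |Real.exp h - 1|
              ≤ Real.exp (-a * ((l - k : ℤ) : ℝ) ^ 2 + (2 * a) * J) * (w k * Real.exp J) *
                (η * J * Real.exp J) := by
                have hwl : 0 ≤ w l := (Real.exp_pos _).le
                have hwk : 0 ≤ w k := (Real.exp_pos _).le
                have := hgb l
                gcongr
            _ ≤ Real.exp (-a * ((l - k : ℤ) : ℝ) ^ 2 + (2 * a) * J) * (w k * Real.exp J) *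
                (η * Real.exp J * Real.exp J) := by
                have hwk : 0 ≤ w k := (Real.exp_pos _).le
                gcongr
            _ = _ := by
                have : Real.exp (-a * ((l - k : ℤ) : ℝ) ^ 2 + (3 + 2 * a) * J) =
                    Real.exp (-a * ((l - k : ℤ) : ℝ) ^ 2 + (2 * a) * J) *
                    (Real.exp J * Real.exp J * Real.exp J) := by
                  rw [← Real.exp_add, ← Real.exp_add, ← Real.exp_add]; congr 1; ring
                rw [this]; ring
        have hs1' : Summable fun l : ℤ => sg l * w l * Real.exp (-a * (s + l - 1 * k) ^ 2) := by
          have h1 : Summable fun l : ℤ =>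
              sg l * w l * Real.exp (-a * (s + l - 1 * k) ^ 2) - W * B l :=
            Summable.of_norm_bounded (hMk.mul_left _) hkey
          have h2 := h1.add (hBsum.mul_left W)
          simpa using h2
        have hz' : ∑' l, W * B l = 0 := by rw [tsum_mul_left, hz, mul_zero]
        have : ∑' l : ℤ, sg l * w l * Real.exp (-a * (s + l - 1 * k) ^ 2) =
            ∑' l : ℤ, (sg l * w l * Real.exp (-a * (s + l - 1 * k) ^ 2) - W * B l) := by
          rw [hs1'.tsum_sub (hBsum.mul_left W), hz', sub_zero]
        rw [this]
        have h3 := tsum_of_norm_bounded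
          (f := fun l : ℤ => sg l * w l * Real.exp (-a * (s + l - 1 * k) ^ 2) - W * B l)
          (hMk.mul_left (η * w k)).hasSum (fun l => hkey l)
        rw [tsum_mul_left, hMk', Real.norm_eq_abs] at h3
        linarith
      have hsq : ∀ l, ENNReal.ofReal ((sg l * w l) ^ 2) = ENNReal.ofReal (w l ^ 2) := by
        intro l
        rw [mul_pow, ← sq_abs (sg l), sg_abs]; simp
      simp only [hsq]
      rw [← ENNReal.tsum_mul_left]
      refine ENNReal.tsum_le_tsum fun k => ?_
      rw [← ENNReal.ofReal_mul hε.le]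
      refine ENNReal.ofReal_le_ofReal ?_
      have h1 := pow_le_pow_left₀ (abs_nonneg _) (hP k) 2
      rw [sq_abs] at h1
      refine h1.trans ?_
      calc (η * M * w k) ^ 2 = η ^ 2 * M ^ 2 * w k ^ 2 := by ring
        _ ≤ _ := mul_le_mul_of_nonneg_right hηM (sq_nonneg _)

lemma enorm_prodC {ι : Type*} (s : Finset ι) (f : ι → ℂ) :
    ‖∏ i ∈ s, f i‖ₑ = ∏ i ∈ s, ‖f i‖ₑ := by
  simp only [← ofReal_norm]
  rw [norm_prod, ENNReal.ofReal_prod_of_nonneg fun _ _ => norm_nonneg _]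

lemma tsum_pi_ennreal : ∀ (n : ℕ) (u : Fin n → ℤ → ℝ≥0∞),
    ∑' k : Fin n → ℤ, ∏ i, u i (k i) = ∏ i, ∑' j, u i j := by
  intro n
  induction n with
  | zero => intro u; simp
  | succ n ih =>
    intro u
    rw [← (Fin.consEquiv fun _ : Fin (n + 1) => ℤ).tsum_eq, ENNReal.tsum_prod',
      Fin.prod_univ_succ, ← ih (fun i => u i.succ), ← ENNReal.tsum_mul_right]
    congr 1
    ext j
    rw [← ENNReal.tsum_mul_left]
    congr 1
    ext k
    simp [Fin.consEquiv, Fin.prod_univ_succ]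

lemma tsum_pi_complex : ∀ (n : ℕ) (u : Fin n → ℤ → ℂ), (∀ i, Summable fun j => ‖u i j‖) →
    (Summable fun k : Fin n → ℤ => ‖∏ i, u i (k i)‖) ∧
    ∑' k : Fin n → ℤ, ∏ i, u i (k i) = ∏ i, ∑' j, u i j := by
  intro n
  induction n with
  | zero =>
    intro u _
    refine ⟨?_, by simp⟩
    exact (hasSum_fintype _).summable
  | succ n ih =>
    intro u hu
    obtain ⟨hs, he⟩ := ih (fun i => u i.succ) (fun i => hu i.succ)
    have hfun : ∀ x : ℤ × (Fin n → ℤ), ∏ i, u i ((Fin.consEquiv fun _ : Fin (n + 1) => ℤ) x i) =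
        u 0 x.1 * ∏ i : Fin n, u i.succ (x.2 i) := by
      intro x
      simp [Fin.consEquiv, Fin.prod_univ_succ]
    constructor
    · rw [← (Fin.consEquiv fun _ : Fin (n + 1) => ℤ).summable_iff]
      have := (hu 0).mul_norm hs
      refine this.congr fun x => ?_
      simp only [Function.comp]
      rw [hfun]
    · rw [← (Fin.consEquiv fun _ : Fin (n + 1) => ℤ).tsum_eq, Fin.prod_univ_succ, ← he,
        tsum_mul_tsum_of_summable_norm (hu 0) hs]
      congr 1
      ext x
      rw [hfun]

lemma cs_tsum {ι : Type*} (M c : ι → ℝ≥0∞) :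
    (∑' l, M l * c l) ^ 2 ≤ (∑' l, M l) * ∑' l, M l * c l ^ 2 := by
  letI : MeasurableSpace ι := ⊤
  have h := ENNReal.lintegral_mul_le_Lp_mul_Lq (Measure.count : Measure ι)
    Real.HolderConjugate.two_two (f := fun l => M l ^ (1 / 2 : ℝ))
    (g := fun l => M l ^ (1 / 2 : ℝ) * c l)
    (measurable_from_top).aemeasurable (measurable_from_top).aemeasurable
  simp only [lintegral_count, Pi.mul_apply] at h
  have e1 : ∀ l, M l ^ (1 / 2 : ℝ) * (M l ^ (1 / 2 : ℝ) * c l) = M l * c l := by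
    intro l
    rw [← mul_assoc, ← ENNReal.rpow_add_of_nonneg _ _ (by norm_num) (by norm_num)]
    norm_num
  have e2 : ∀ l, (M l ^ (1 / 2 : ℝ)) ^ (2 : ℝ) = M l := by
    intro l
    rw [← ENNReal.rpow_mul]; norm_num
  have e3 : ∀ l, (M l ^ (1 / 2 : ℝ) * c l) ^ (2 : ℝ) = M l * c l ^ 2 := by
    intro l
    rw [ENNReal.mul_rpow_of_nonneg _ _ (by norm_num), e2]; norm_num
  simp only [e1, e2, e3] at h
  have h2 := pow_le_pow_left₀ (zero_le) h 2
  refine h2.trans (le_of_eq ?_)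
  rw [mul_pow, ← ENNReal.rpow_natCast, ← ENNReal.rpow_natCast, ← ENNReal.rpow_mul,
    ← ENNReal.rpow_mul]
  norm_num

lemma schur {ι κ : Type*} (M : κ → ι → ℝ≥0∞) (c : ι → ℝ≥0∞) {R C : ℝ≥0∞}
    (hR : ∀ k, ∑' l, M k l ≤ R) (hC : ∀ l, ∑' k, M k l ≤ C) :
    ∑' k, (∑' l, M k l * c l) ^ 2 ≤ R * C * ∑' l, c l ^ 2 := by
  calc ∑' k, (∑' l, M k l * c l) ^ 2 ≤ ∑' k, R * ∑' l, M k l * c l ^ 2 := by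
        refine ENNReal.tsum_le_tsum fun k => (cs_tsum _ _).trans ?_
        gcongr
        exact hR k
    _ = R * ∑' l, (∑' k, M k l) * c l ^ 2 := by
        rw [ENNReal.tsum_mul_left, ENNReal.tsum_comm]
        simp only [ENNReal.tsum_mul_right]
    _ ≤ R * ∑' l, C * c l ^ 2 := by
        gcongr with l
        exact hC l
    _ = _ := by rw [ENNReal.tsum_mul_left, mul_assoc]

/-- multivariate gaussian matrix -/
def gR {n : ℕ} (a ρ : ℝ) (s : Fin n → ℝ) (k l : Fin n → ℤ) : ℝ :=
  ∏ i, Real.exp (-a * (s i + l i - ρ * k i) ^ 2)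

lemma gR_pos {n : ℕ} (a ρ : ℝ) (s : Fin n → ℝ) (k l : Fin n → ℤ) : 0 < gR a ρ s k l :=
  Finset.prod_pos fun _ _ => Real.exp_pos _

lemma gR_ofReal {n : ℕ} (a ρ : ℝ) (s : Fin n → ℝ) (k l : Fin n → ℤ) :
    ENNReal.ofReal (gR a ρ s k l) =
      ∏ i, ENNReal.ofReal (Real.exp (-a * (s i + l i - ρ * k i) ^ 2)) :=
  ENNReal.ofReal_prod_of_nonneg fun _ _ => (Real.exp_pos _).le

lemma gR_sums (n : ℕ) {a ρ : ℝ} (ha : 0 < a) (hρ : 0 < ρ) : ∃ K : ℝ≥0∞, K ≠ ⊤ ∧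
    (∀ (s : Fin n → ℝ) (k : Fin n → ℤ), ∑' l, ENNReal.ofReal (gR a ρ s k l) ≤ K) ∧
    (∀ (s : Fin n → ℝ) (l : Fin n → ℤ), ∑' k, ENNReal.ofReal (gR a ρ s k l) ≤ K) := by
  obtain ⟨C1, hC1, h1⟩ := gauss_unif ha hρ
  obtain ⟨C2, hC2, h2⟩ := gauss_unif' ha
  refine ⟨max C1 C2 ^ n, ENNReal.pow_ne_top (by simp [hC1, hC2]), fun s k => ?_, fun s l => ?_⟩
  · simp only [gR_ofReal]
    rw [tsum_pi_ennreal n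
      (fun i j => ENNReal.ofReal (Real.exp (-a * (s i + j - ρ * k i) ^ 2)))]
    calc _ ≤ ∏ i : Fin n, max C1 C2 := by
          refine Finset.prod_le_prod' fun i _ => le_trans ?_ (le_max_right _ _)
          refine le_trans (le_of_eq ?_) (h2 (s i - ρ * k i))
          congr 1; ext j; congr 3; ring
      _ = _ := by simp
  · simp only [gR_ofReal]
    rw [tsum_pi_ennreal n
      (fun i j => ENNReal.ofReal (Real.exp (-a * (s i + l i - ρ * j) ^ 2)))]
    calc _ ≤ ∏ i : Fin n, max C1 C2 := by
          refine Finset.prod_le_prod' fun i _ => le_trans ?_ (le_max_left _ _)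
          exact h1 (s i + l i)
      _ = _ := by simp

lemma upper_pt (n : ℕ) {a ρ : ℝ} (ha : 0 < a) (hρ : 0 < ρ) : ∃ K : ℝ≥0∞, K ≠ ⊤ ∧
    ∀ (s : Fin n → ℝ) (c : (Fin n → ℤ) → ℝ≥0∞),
      ∑' k, (∑' l, ENNReal.ofReal (gR a ρ s k l) * c l) ^ 2 ≤ K * ∑' l, c l ^ 2 := by
  obtain ⟨K, hK, h1, h2⟩ := gR_sums n ha hρ
  exact ⟨K * K, ENNReal.mul_ne_top hK hK, fun s c => schur _ c (h1 s) (h2 s)⟩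

lemma lower_pt (n : ℕ) {a ρ : ℝ} (ha : 0 < a) (hρ : 0 < ρ) (hρ1 : ρ < 1) :
    ∃ K : ℝ≥0∞, K ≠ ⊤ ∧
    ∀ (s : Fin n → ℝ) (c : (Fin n → ℤ) → ℂ), ∑' l, ‖c l‖ₑ ^ 2 ≠ ⊤ →
      ∑' l, ‖c l‖ₑ ^ 2 ≤ K * ∑' k, ‖∑' l, c l * (gR a ρ s k l : ℂ)‖ₑ ^ 2 := by
  obtain ⟨γ, C, a', hC, ha', hγ, hdual⟩ := exists_dual ha hρ hρ1
  obtain ⟨K, hK, h1, h2⟩ := gR_sums n ha hρ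
  obtain ⟨K', hK', h1', h2'⟩ := gR_sums n ha' hρ
  set R : ℝ≥0∞ := ENNReal.ofReal C ^ n * K' with hR
  have hRtop : R ≠ ⊤ := ENNReal.mul_ne_top (ENNReal.pow_ne_top ENNReal.ofReal_ne_top) hK'
  refine ⟨R * R, ENNReal.mul_ne_top hRtop hRtop, fun s c hc => ?_⟩
  set Γ : (Fin n → ℤ) → (Fin n → ℤ) → ℂ :=
    fun k l => ∏ i, (γ (s i + l i - ρ * k i) : ℂ) with hΓ
  have hΓb : ∀ k l, ‖Γ k l‖ₑ ≤ ENNReal.ofReal C ^ n * ENNReal.ofReal (gR a' ρ s k l) := by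
    intro k l
    rw [gR_ofReal, hΓ]
    simp only
    rw [show ENNReal.ofReal C ^ n = ∏ i : Fin n, ENNReal.ofReal C by simp,
      ← Finset.prod_mul_distrib, enorm_prodC]
    refine Finset.prod_le_prod' fun i _ => ?_
    rw [← ENNReal.ofReal_mul hC, ← ofReal_norm]
    refine ENNReal.ofReal_le_ofReal ?_
    rw [Complex.norm_real, Real.norm_eq_abs]
    exact hγ _
  have hΓr : ∀ k, ∑' l, ‖Γ k l‖ₑ ≤ R := fun k => by
    refine (ENNReal.tsum_le_tsum fun l => hΓb k l).trans ?_
    rw [ENNReal.tsum_mul_left]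
    exact mul_le_mul' le_rfl (h1' s k)
  have hΓc : ∀ l, ∑' k, ‖Γ k l‖ₑ ≤ R := fun l => by
    refine (ENNReal.tsum_le_tsum fun k => hΓb k l).trans ?_
    rw [ENNReal.tsum_mul_left]
    exact mul_le_mul' le_rfl (h2' s l)
  set P : (Fin n → ℤ) → ℂ := fun k => ∑' l, c l * (gR a ρ s k l : ℂ) with hP
  -- biorthogonality
  have hbi : ∀ l l' : Fin n → ℤ, ∑' k, Γ k l' * (gR a ρ s k l : ℂ) = if l = l' then 1 else 0 := by
    intro l l'
    set u : Fin n → ℤ → ℂ := fun i j =>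
      ((γ ((s i + l' i) - ρ * j) *
        Real.exp (-a * ((s i + l' i) - ρ * j + ((l i - l' i : ℤ) : ℝ)) ^ 2) : ℝ) : ℂ) with hu
    have hterm : ∀ k, Γ k l' * (gR a ρ s k l : ℂ) = ∏ i, u i (k i) := by
      intro k
      simp only [hΓ, gR, hu]
      rw [Complex.ofReal_prod, ← Finset.prod_mul_distrib]
      refine Finset.prod_congr rfl fun i _ => ?_
      rw [← Complex.ofReal_mul]
      congr 4
      push_cast
      ring
    have hus : ∀ i, Summable fun j => ‖u i j‖ := by
      intro i
      have := (hdual (s i + l' i) (l i - l' i)).summable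
      have := this.abs
      refine this.congr fun j => ?_
      simp only [hu]
      rw [Complex.norm_real, Real.norm_eq_abs]
    have hut : ∀ i, ∑' j, u i j = if l i = l' i then 1 else 0 := by
      intro i
      have h := (hdual (s i + l' i) (l i - l' i)).tsum_eq
      simp only [hu]
      rw [← Complex.ofReal_tsum, h]
      simp only [sub_eq_zero]
      split_ifs <;> simp
    simp only [hterm]
    rw [(tsum_pi_complex n u hus).2]
    simp only [hut]
    by_cases hl : l = l'
    · subst hl; simp
    · rw [if_neg hl]
      obtain ⟨i, hi⟩ := Function.ne_iff.mp hl
      exact Finset.prod_eq_zero (Finset.mem_univ i) (if_neg hi)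
  -- boundedness of c
  have hcm : ∃ m : ℝ≥0∞, m ≠ ⊤ ∧ ∀ l, ‖c l‖ₑ ≤ m := by
    refine ⟨1 + ∑' l, ‖c l‖ₑ ^ 2, by simp [hc], fun l => ?_⟩
    have hl : ‖c l‖ₑ ^ 2 ≤ ∑' l, ‖c l‖ₑ ^ 2 := ENNReal.le_tsum l
    rcases le_total ‖c l‖ₑ 1 with h | h
    · exact h.trans (le_self_add)
    · calc ‖c l‖ₑ = ‖c l‖ₑ * 1 := (mul_one _).symm
        _ ≤ ‖c l‖ₑ * ‖c l‖ₑ := by gcongr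
        _ = ‖c l‖ₑ ^ 2 := (pow_two _).symm
        _ ≤ _ := hl.trans le_add_self
  obtain ⟨m, hm, hcm⟩ := hcm
  have hrec : ∀ l', c l' = ∑' k, Γ k l' * P k := by
    intro l'
    have hsum : Summable (Function.uncurry fun (k l : Fin n → ℤ) =>
        Γ k l' * (c l * (gR a ρ s k l : ℂ))) := by
      have hfin : ∑' x : (Fin n → ℤ) × (Fin n → ℤ),
          ‖Γ x.1 l' * (c x.2 * (gR a ρ s x.1 x.2 : ℂ))‖ₑ ≠ ⊤ := by
        refine ne_top_of_le_ne_top (b := R * (m * K)) ?_ ?_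
        · exact ENNReal.mul_ne_top hRtop (ENNReal.mul_ne_top hm hK)
        rw [ENNReal.tsum_prod (f := fun k l => ‖Γ k l' * (c l * (gR a ρ s k l : ℂ))‖ₑ)]
        calc _ ≤ ∑' k, ‖Γ k l'‖ₑ * (m * K) := by
              refine ENNReal.tsum_le_tsum fun k => ?_
              simp only [enorm_mul]
              rw [ENNReal.tsum_mul_left]
              gcongr
              calc _ ≤ ∑' l, m * ENNReal.ofReal (gR a ρ s k l) := by
                    refine ENNReal.tsum_le_tsum fun l => ?_
                    have : ‖(gR a ρ s k l : ℂ)‖ₑ = ENNReal.ofReal (gR a ρ s k l) := by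
                      rw [← ofReal_norm, Complex.norm_real, Real.norm_eq_abs,
                        abs_of_pos (gR_pos _ _ _ _ _)]
                    rw [this]
                    gcongr
                    exact hcm l
                _ ≤ _ := by
                    rw [ENNReal.tsum_mul_left]
                    gcongr
                    exact h1 s k
          _ ≤ _ := by
              rw [ENNReal.tsum_mul_right]
              gcongr
              exact hΓc l'
      exact Summable.of_enorm hfin
    calc c l' = ∑' l, c l * (if l = l' then 1 else 0) := by
          simp
      _ = ∑' l, ∑' k, Γ k l' * (c l * (gR a ρ s k l : ℂ)) := by
          congr 1; ext l
          rw [← hbi l l', ← tsum_mul_left]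
          congr 1; ext k; ring
      _ = ∑' k, ∑' l, Γ k l' * (c l * (gR a ρ s k l : ℂ)) := hsum.tsum_comm
      _ = _ := by
          congr 1; ext k
          rw [tsum_mul_left]
  calc ∑' l, ‖c l‖ₑ ^ 2 ≤ ∑' l, (∑' k, ‖Γ k l‖ₑ * ‖P k‖ₑ) ^ 2 := by
        refine ENNReal.tsum_le_tsum fun l => ?_
        gcongr
        conv_lhs => rw [hrec l]
        refine (enorm_tsum_le_tsum_enorm).trans (le_of_eq ?_)
        simp only [enorm_mul]
    _ ≤ R * R * ∑' k, ‖P k‖ₑ ^ 2 := schur (fun l k => ‖Γ k l‖ₑ) _ hΓc hΓr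

/-- unit box -/
def box (n : ℕ) : Set (Fin n → ℝ) := {x | ∀ i, x i ∈ Set.Ioc (0 : ℝ) 1}

lemma measurableSet_box (n : ℕ) : MeasurableSet (box n) :=
  MeasurableSet.univ_pi' (fun _ => measurableSet_Ioc)

/-- character -/
def ch {n : ℕ} (m : Fin n → ℤ) (s : Fin n → ℝ) : ℂ :=
  Complex.exp (-(2 * (Real.pi : ℂ) * Complex.I * ((∑ i, (m i : ℝ) * s i : ℝ) : ℂ)))

lemma ch_norm {n : ℕ} (m : Fin n → ℤ) (s : Fin n → ℝ) : ‖ch m s‖ = 1 := by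
  rw [ch, show -(2 * (Real.pi : ℂ) * Complex.I * ((∑ i, (m i : ℝ) * s i : ℝ) : ℂ)) =
    ((-(2 * Real.pi * ∑ i, (m i : ℝ) * s i) : ℝ) : ℂ) * Complex.I by push_cast; ring]
  exact Complex.norm_exp_ofReal_mul_I _

lemma ch_continuous {n : ℕ} (m : Fin n → ℤ) : Continuous (ch m) := by
  unfold ch; fun_prop

lemma ch_add {n : ℕ} (m l : Fin n → ℤ) (s : Fin n → ℝ) : ch m (fun i => s i + l i) = ch m s := by
  unfold ch
  rw [Complex.exp_eq_exp_iff_exists_int]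
  refine ⟨-∑ i, m i * l i, ?_⟩
  push_cast
  simp only [mul_add, Finset.sum_add_distrib]
  ring

lemma mFourier_ch {n : ℕ} (m : Fin n → ℤ) (s : Fin n → ℝ) :
    UnitAddTorus.mFourier (-m) (fun i => (s i : UnitAddCircle)) = ch m s := by
  unfold ch
  simp only [UnitAddTorus.mFourier, ContinuousMap.coe_mk, fourier_coe_apply]
  rw [← Complex.exp_sum]
  congr 1
  push_cast
  rw [Finset.mul_sum, ← Finset.sum_neg_distrib]
  refine Finset.sum_congr rfl fun i _ => ?_
  simp
  ring

local instance : MeasureSpace UnitAddCircle := ⟨AddCircle.haarAddCircle⟩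

lemma parseval_box {n : ℕ} (P : (Fin n → ℝ) → ℂ) (hP : Measurable P)
    (hfin : ∫⁻ s in box n, ‖P s‖ₑ ^ 2 ≠ ⊤) :
    ∑' m : Fin n → ℤ, ‖∫ s in box n, ch m s * P s‖ₑ ^ 2 = ∫⁻ s in box n, ‖P s‖ₑ ^ 2 := by
  have hbox : box n = {x : Fin n → ℝ | ∀ i, x i ∈ Set.Ioc ((0 : Fin n → ℝ) i) ((0 : Fin n → ℝ) i + 1)} := by
    ext x; simp [box]
  set e := UnitAddTorus.measurableEquivPiIoc (0 : Fin n → ℝ) with he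
  set p : UnitAddTorus (Fin n) → ℂ := fun x => P (e x).1 with hp
  have hpm : Measurable p := hP.comp (measurable_subtype_coe.comp e.measurable)
  have hpx : ∀ x ∈ box n, p (fun i => (x i : UnitAddCircle)) = P x := by
    intro x hx
    rw [hbox] at hx
    have := e.apply_symm_apply ⟨x, hx⟩
    simp only [hp]
    rw [he] at this ⊢
    rw [UnitAddTorus.coe_symm_measurableEquivPiIoc_apply] at this
    rw [this]
  have hl : ∫⁻ x, ‖p x‖ₑ ^ 2 = ∫⁻ s in box n, ‖P s‖ₑ ^ 2 := by
    have h := UnitAddTorus.lintegral_preimage (fun x => ‖p x‖ₑ ^ 2) (0 : Fin n → ℝ)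
    rw [← hbox] at h
    refine h.trans ?_
    refine setLIntegral_congr_fun (measurableSet_box n) fun x hx => ?_
    simp only [hpx x hx]
  have hmem : MemLp p 2 volume := by
    refine ⟨hpm.aestronglyMeasurable, ?_⟩
    rw [eLpNorm_lt_top_iff_lintegral_rpow_enorm_lt_top (by norm_num) (by norm_num)]
    simp only [ENNReal.toReal_ofNat, ENNReal.rpow_ofNat]
    rw [hl]
    exact lt_top_iff_ne_top.mpr hfin
  have hH := UnitAddTorus.hasSum_sq_mFourierCoeff (hmem.toLp p)
  have hco : ∀ m, UnitAddTorus.mFourierCoeff (hmem.toLp p) m = ∫ s in box n, ch m s * P s := by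
    intro m
    have h1 : UnitAddTorus.mFourierCoeff (hmem.toLp p) m = UnitAddTorus.mFourierCoeff p m := by
      refine integral_congr_ae ?_
      filter_upwards [hmem.coeFn_toLp] with x hx
      rw [hx]
    rw [h1, UnitAddTorus.mFourierCoeff_eq_integral p m 0, ← hbox]
    refine setIntegral_congr_fun (measurableSet_box n) fun x hx => ?_
    simp only [hpx x hx, mFourier_ch, smul_eq_mul]
  simp only [hco] at hH
  have h2 : ENNReal.ofReal (∫ t, ‖(hmem.toLp p) t‖ ^ 2) = ∫⁻ s in box n, ‖P s‖ₑ ^ 2 := by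
    rw [← hl]
    have : ∫ t, ‖(hmem.toLp p) t‖ ^ 2 = ∫ t, ‖p t‖ ^ 2 := by
      refine integral_congr_ae ?_
      filter_upwards [hmem.coeFn_toLp] with x hx
      rw [hx]
    rw [this, ofReal_integral_eq_lintegral_ofReal]
    · congr 1; ext x
      rw [ENNReal.ofReal_pow (norm_nonneg _), ofReal_norm]
    · exact hmem.integrable_norm_pow (by norm_num)
    · exact ae_of_all _ fun _ => by positivity
  rw [← h2, ← hH.tsum_eq, ENNReal.ofReal_tsum_of_nonneg (fun _ => by positivity) hH.summable]
  congr 1; ext m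
  rw [ENNReal.ofReal_pow (norm_nonneg _), ofReal_norm]

/-- shifted cells -/
def cell {n : ℕ} (l : Fin n → ℤ) : Set (Fin n → ℝ) := {x | ∀ i, x i ∈ Set.Ioc (l i : ℝ) (l i + 1)}

lemma measurableSet_cell {n : ℕ} (l : Fin n → ℤ) : MeasurableSet (cell l) :=
  MeasurableSet.univ_pi' (fun _ => measurableSet_Ioc)

/-- integer part with respect to half open cells -/
def ip (t : ℝ) : ℤ := ⌈t⌉ - 1

lemma mem_Ioc_iff_ip (t : ℝ) (l : ℤ) : t ∈ Set.Ioc (l : ℝ) (l + 1) ↔ ip t = l := by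
  unfold ip
  rw [sub_eq_iff_eq_add, Int.ceil_eq_iff, Set.mem_Ioc]
  push_cast
  simp

lemma mem_cell_iff {n : ℕ} (l : Fin n → ℤ) (x : Fin n → ℝ) :
    x ∈ cell l ↔ (fun i => ip (x i)) = l := by
  simp only [cell, Set.mem_ofPred_eq, mem_Ioc_iff_ip, funext_iff]

lemma cell_disj {n : ℕ} : Pairwise (Function.onFun Disjoint (cell (n := n))) := by
  intro l l' h
  rw [Function.onFun, Set.disjoint_left]
  intro x hx hx'
  rw [mem_cell_iff] at hx hx'
  exact h (hx.symm.trans hx')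

lemma cell_union {n : ℕ} : ⋃ l, cell (n := n) l = Set.univ := by
  ext x
  simp [mem_cell_iff]

lemma preimage_cell {n : ℕ} (l : Fin n → ℤ) :
    (fun s : Fin n → ℝ => s + (iC l : Fin n → ℝ)) ⁻¹' cell l = box n := by
  ext x
  simp only [cell, box, iC, Set.mem_preimage, Set.mem_ofPred_eq, Set.mem_Ioc, Pi.add_apply]
  refine forall_congr' fun i => ?_
  constructor <;> rintro ⟨h1, h2⟩ <;> constructor <;> linarith

lemma lintegral_unfold {n : ℕ} (h : (Fin n → ℝ) → ℝ≥0∞) (hm : Measurable h) :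
    ∫⁻ x, h x = ∫⁻ s in box n, ∑' l : Fin n → ℤ, h (s + iC l) := by
  have hm' : ∀ l : Fin n → ℤ, AEMeasurable (fun s => h (s + iC l)) (volume.restrict (box n)) :=
    fun l => (hm.comp (measurable_id.add_const _)).aemeasurable
  rw [lintegral_tsum hm', ← setLIntegral_univ, ← cell_union, lintegral_iUnion measurableSet_cell cell_disj]
  congr 1; ext l
  rw [← preimage_cell l]
  exact ((measurePreserving_add_right volume (iC l : Fin n → ℝ)).setLIntegral_comp_preimage
    (measurableSet_cell l) hm).symm

lemma integral_unfold {n : ℕ} (h : (Fin n → ℝ) → ℂ) (hm : Measurable h) (hi : Integrable h) :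
    ∫ x, h x = ∫ s in box n, ∑' l : Fin n → ℤ, h (s + iC l) := by
  have hl := lintegral_unfold (fun x => ‖h x‖ₑ) hm.enorm
  have hm' : ∀ l : Fin n → ℤ, AEMeasurable (fun s => ‖h (s + iC l)‖ₑ) (volume.restrict (box n)) :=
    fun l => (hm.enorm.comp (measurable_id.add_const _)).aemeasurable
  have hm2 : ∀ l : Fin n → ℤ,
      AEStronglyMeasurable (fun s => h (s + iC l)) (volume.restrict (box n)) :=
    fun l => (hm.comp (measurable_id.add_const _)).aestronglyMeasurable
  rw [lintegral_tsum hm'] at hl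
  rw [integral_tsum hm2]
  · rw [← setIntegral_univ, ← cell_union, integral_iUnion measurableSet_cell cell_disj
      hi.integrableOn]
    congr 1; ext l
    rw [← preimage_cell l]
    exact ((measurePreserving_add_right volume (iC l : Fin n → ℝ)).setIntegral_preimage_emb
      (measurableEmbedding_addRight _) _ _).symm
  · exact hl ▸ hi.2.ne

lemma gR_shift {n : ℕ} (a ρ : ℝ) (s : Fin n → ℝ) (k l : Fin n → ℤ) :
    gR a ρ (s + iC l) k 0 = gR a ρ s k l := by
  simp [gR, iC]

lemma gR_measurable {n : ℕ} (a ρ : ℝ) (k l : Fin n → ℤ) :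
    Measurable (fun s : Fin n → ℝ => gR a ρ s k l) := by
  unfold gR
  have : Continuous (fun s : Fin n → ℝ => ∏ i, Real.exp (-a * (s i + l i - ρ * k i) ^ 2)) := by
    fun_prop
  exact this.measurable

lemma gR_enorm {n : ℕ} (a ρ : ℝ) (s : Fin n → ℝ) (k l : Fin n → ℤ) :
    ‖(gR a ρ s k l : ℂ)‖ₑ = ENNReal.ofReal (gR a ρ s k l) := by
  rw [← ofReal_norm, Complex.norm_real, Real.norm_eq_abs, abs_of_pos (gR_pos _ _ _ _ _)]

lemma vol_box (n : ℕ) : volume (box n) = 1 := by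
  have : box n = Set.univ.pi (fun _ : Fin n => Set.Ioc (0 : ℝ) 1) := by
    ext x; simp [box]
  rw [this, volume_pi_pi]
  simp

lemma star_id {n : ℕ} {a ρ : ℝ} (ha : 0 < a) (hρ : 0 < ρ) (F : (Fin n → ℝ) → ℂ)
    (hF : Measurable F) (hfin : ∫⁻ s, ‖F s‖ₑ ^ 2 ≠ ⊤) :
    ∑' km : (Fin n → ℤ) × (Fin n → ℤ), ‖∫ s, ch km.2 s * (F s * (gR a ρ s km.1 0 : ℂ))‖ₑ ^ 2 =
    ∫⁻ s in box n, ∑' k, ‖∑' l, F (s + iC l) * (gR a ρ s k l : ℂ)‖ₑ ^ 2 := by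
  obtain ⟨K, hK, hup⟩ := upper_pt n ha hρ
  have hN := lintegral_unfold (fun s => ‖F s‖ₑ ^ 2) (hF.enorm.pow_const 2)
  have hQ : ∀ k, ∫⁻ s in box n, (∑' l, ENNReal.ofReal (gR a ρ s k l) * ‖F (s + iC l)‖ₑ) ^ 2 ≠ ⊤ := by
    intro k
    refine ne_top_of_le_ne_top (ENNReal.mul_ne_top hK hfin) ?_
    rw [hN, ← lintegral_const_mul' _ _ hK]
    refine lintegral_mono fun s => le_trans ?_ (hup s _)
    exact ENNReal.le_tsum (f := fun k =>
      (∑' l, ENNReal.ofReal (gR a ρ s k l) * ‖F (s + iC l)‖ₑ) ^ 2) k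
  have hmt : ∀ k l, Measurable (fun s => F (s + iC l) * (gR a ρ s k l : ℂ)) := fun k l =>
    (hF.comp (measurable_id.add_const _)).mul
      (Complex.measurable_ofReal.comp (gR_measurable a ρ k l))
  have hPm : ∀ k, Measurable (fun s => ∑' l, F (s + iC l) * (gR a ρ s k l : ℂ)) := fun k =>
    Measurable.tsum (hmt k)
  have hbd : ∀ k s, ‖∑' l, F (s + iC l) * (gR a ρ s k l : ℂ)‖ₑ ≤
      ∑' l, ENNReal.ofReal (gR a ρ s k l) * ‖F (s + iC l)‖ₑ := by
    intro k s
    refine enorm_tsum_le_tsum_enorm.trans (le_of_eq ?_)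
    congr 1; ext l
    rw [enorm_mul, gR_enorm, mul_comm]
  rw [lintegral_tsum (fun k => ((hPm k).enorm.pow_const 2).aemeasurable),
    ENNReal.tsum_prod (f := fun k m => ‖∫ s, ch m s * (F s * (gR a ρ s k 0 : ℂ))‖ₑ ^ 2)]
  congr 1; ext k
  rw [← parseval_box _ (hPm k)]
  · congr 1; ext m
    congr 2
    have hHm : Measurable (fun s => ch m s * (F s * (gR a ρ s k 0 : ℂ))) :=
      (ch_continuous m).measurable.mul (hF.mul
        (Complex.measurable_ofReal.comp (gR_measurable a ρ k 0)))
    rw [integral_unfold _ hHm]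
    · congr 1; ext s
      rw [← tsum_mul_left]
      congr 1; ext l
      rw [gR_shift]
      congr 1
      exact ch_add m l s
    · refine ⟨hHm.aestronglyMeasurable, ?_⟩
      rw [hasFiniteIntegral_iff_enorm, lintegral_unfold _ hHm.enorm]
      have : ∫⁻ s in box n, (1 + (∑' l, ENNReal.ofReal (gR a ρ s k l) * ‖F (s + iC l)‖ₑ) ^ 2) < ⊤ := by
        rw [lintegral_add_left measurable_const, setLIntegral_const, vol_box]
        exact lt_top_iff_ne_top.mpr (by simp [hQ k])
      refine lt_of_le_of_lt (lintegral_mono fun s => ?_) this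
      have e1 : ∑' l, ‖ch m (s + iC l) * (F (s + iC l) * (gR a ρ (s + iC l) k 0 : ℂ))‖ₑ =
          ∑' l, ENNReal.ofReal (gR a ρ s k l) * ‖F (s + iC l)‖ₑ := by
        congr 1; ext l
        rw [enorm_mul, enorm_mul, gR_shift, gR_enorm, ← ofReal_norm (ch _ _), ch_norm]
        simp [mul_comm]
      rw [e1]
      generalize (∑' l, ENNReal.ofReal (gR a ρ s k l) * ‖F (s + iC l)‖ₑ) = x
      rcases le_total x 1 with h | h
      · exact h.trans le_self_add
      · calc x = x * 1 := (mul_one _).symm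
          _ ≤ x * x := by gcongr
          _ = x ^ 2 := (pow_two _).symm
          _ ≤ _ := le_add_self
  · refine ne_top_of_le_ne_top (hQ k) (lintegral_mono fun s => ?_)
    gcongr
    exact hbd k s

/-- the ratio sums -/
def SS {n : ℕ} (a ρ : ℝ) (F : (Fin n → ℝ) → ℂ) : ℝ≥0∞ :=
  ∑' km : (Fin n → ℤ) × (Fin n → ℤ), ‖∫ s, ch km.2 s * (F s * (gR a ρ s km.1 0 : ℂ))‖ₑ ^ 2

lemma SS_upper (n : ℕ) {a ρ : ℝ} (ha : 0 < a) (hρ : 0 < ρ) : ∃ K : ℝ≥0∞, K ≠ ⊤ ∧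
    ∀ F : (Fin n → ℝ) → ℂ, Measurable F → ∫⁻ s, ‖F s‖ₑ ^ 2 ≠ ⊤ →
      SS a ρ F ≤ K * ∫⁻ s, ‖F s‖ₑ ^ 2 := by
  obtain ⟨K, hK, hup⟩ := upper_pt n ha hρ
  refine ⟨K, hK, fun F hF hfin => ?_⟩
  rw [SS, star_id ha hρ F hF hfin,
    lintegral_unfold (fun s => ‖F s‖ₑ ^ 2) (hF.enorm.pow_const 2), ← lintegral_const_mul' _ _ hK]
  refine lintegral_mono fun s => le_trans ?_ (hup s _)
  refine ENNReal.tsum_le_tsum fun k => ?_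
  gcongr
  refine enorm_tsum_le_tsum_enorm.trans (le_of_eq ?_)
  congr 1; ext l
  rw [enorm_mul, gR_enorm, mul_comm]

lemma SS_lower (n : ℕ) {a ρ : ℝ} (ha : 0 < a) (hρ : 0 < ρ) (hρ1 : ρ < 1) : ∃ K : ℝ≥0∞, K ≠ ⊤ ∧
    ∀ F : (Fin n → ℝ) → ℂ, Measurable F → ∫⁻ s, ‖F s‖ₑ ^ 2 ≠ ⊤ →
      ∫⁻ s, ‖F s‖ₑ ^ 2 ≤ K * SS a ρ F := by
  obtain ⟨K, hK, hlow⟩ := lower_pt n ha hρ hρ1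
  refine ⟨K, hK, fun F hF hfin => ?_⟩
  have hN := lintegral_unfold (fun s => ‖F s‖ₑ ^ 2) (hF.enorm.pow_const 2)
  rw [SS, star_id ha hρ F hF hfin, hN, ← lintegral_const_mul' _ _ hK]
  have hm : Measurable (fun s => ∑' l : Fin n → ℤ, ‖F (s + iC l)‖ₑ ^ 2) :=
    Measurable.ennreal_tsum fun l => ((hF.comp (measurable_id.add_const _)).enorm.pow_const 2)
  have hae := ae_lt_top hm (μ := volume.restrict (box n)) (hN ▸ hfin)
  refine lintegral_mono_ae ?_
  filter_upwards [hae] with s hs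
  exact hlow s (fun l => F (s + iC l)) hs.ne

lemma ip_measurable : Measurable ip := by
  unfold ip
  exact (Int.measurable_ceil).sub_const 1

lemma ip_add {t : ℝ} (ht : t ∈ Set.Ioc (0 : ℝ) 1) (l : ℤ) : ip (t + l) = l := by
  rw [← mem_Ioc_iff_ip]
  exact ⟨by linarith [ht.1], by linarith [ht.2]⟩

/-- one dimensional building block -/
def f1 (φ : ℝ → ℤ → ℝ) (u v : ℝ) (t : ℝ) : ℝ :=
  (Set.Ioc u v).indicator (fun s => φ s (ip t)) (t - ip t)

lemma f1_measurable {φ : ℝ → ℤ → ℝ} {u v : ℝ} (hφ : ∀ l, Continuous fun s => φ s l) :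
    Measurable (f1 φ u v) := by
  have h : Measurable (fun p : ℝ × ℤ => (Set.Ioc u v).indicator (fun s => φ s p.2) p.1) := by
    refine measurable_from_prod_countable_left fun l => ?_
    exact (hφ l).measurable.indicator measurableSet_Ioc
  have h2 : Measurable (fun t : ℝ => (t - (ip t : ℝ), ip t)) :=
    (measurable_id.sub ((measurable_from_top (f := fun z : ℤ => (z : ℝ))).comp ip_measurable)).prodMk
      ip_measurable
  exact h.comp h2

lemma f1_add {φ : ℝ → ℤ → ℝ} {u v : ℝ} {s : ℝ} (hs : s ∈ Set.Ioc (0 : ℝ) 1) (l : ℤ) :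
    f1 φ u v (s + l) = (Set.Ioc u v).indicator (fun s => φ s l) s := by
  unfold f1
  rw [ip_add hs l]
  simp

lemma enorm_real_sq (x : ℝ) : ‖(x : ℂ)‖ₑ ^ 2 = ENNReal.ofReal (x ^ 2) := by
  rw [← ofReal_norm, Complex.norm_real, ← ENNReal.ofReal_pow (norm_nonneg _), Real.norm_eq_abs,
    sq_abs]

lemma SS_counter (n : ℕ) (hn : 1 ≤ n) {a ρ ε : ℝ} (ha : 0 < a) (hρ : 1 ≤ ρ) (hε : 0 < ε)
    (hε1 : ε ≤ 1) :
    ∃ F : (Fin n → ℝ) → ℂ, Measurable F ∧ ∫⁻ s, ‖F s‖ₑ ^ 2 ≠ ⊤ ∧ ∫⁻ s, ‖F s‖ₑ ^ 2 ≠ 0 ∧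
      SS a ρ F ≤ ENNReal.ofReal ε * ∫⁻ s, ‖F s‖ₑ ^ 2 := by
  obtain ⟨φ, u, v, D, hu, huv, hv, hD, hφc, hφ⟩ := exists_approx_kernel ha hρ hε
  have hρ0 : 0 < ρ := by linarith
  set F : (Fin n → ℝ) → ℂ := fun t => ∏ i, ((f1 φ u v (t i) : ℝ) : ℂ) with hFdef
  have hF : Measurable F := by
    refine Finset.measurable_fun_prod _ fun i _ => ?_
    exact Complex.measurable_ofReal.comp ((f1_measurable hφc).comp (measurable_pi_apply i))
  have hFs : ∀ s ∈ box n, ∀ l : Fin n → ℤ, F (s + iC l) =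
      ∏ i, (((Set.Ioc u v).indicator (fun s => φ s (l i)) (s i) : ℝ) : ℂ) := by
    intro s hs l
    simp only [hFdef]
    refine Finset.prod_congr rfl fun i _ => ?_
    rw [Pi.add_apply, iC, f1_add (hs i)]
  have hFin : ∀ s ∈ box n, (∀ i, s i ∈ Set.Ioc u v) → ∀ l : Fin n → ℤ, F (s + iC l) =
      ∏ i, ((φ (s i) (l i) : ℝ) : ℂ) := by
    intro s hs hi l
    rw [hFs s hs l]
    refine Finset.prod_congr rfl fun i _ => ?_
    rw [Set.indicator_of_mem (hi i)]
  have hFout : ∀ s ∈ box n, (¬ ∀ i, s i ∈ Set.Ioc u v) → ∀ l : Fin n → ℤ, F (s + iC l) = 0 := by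
    intro s hs hi l
    rw [hFs s hs l]
    push Not at hi
    obtain ⟨i, hi⟩ := hi
    refine Finset.prod_eq_zero (Finset.mem_univ i) ?_
    rw [Set.indicator_of_notMem hi]
    simp
  have hsq : ∀ s ∈ box n, (∀ i, s i ∈ Set.Ioc u v) →
      ∑' l : Fin n → ℤ, ‖F (s + iC l)‖ₑ ^ 2 = ∏ i, ∑' j : ℤ, ENNReal.ofReal (φ (s i) j ^ 2) := by
    intro s hs hi
    rw [← tsum_pi_ennreal n (fun i j => ENNReal.ofReal (φ (s i) j ^ 2))]
    congr 1; ext l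
    rw [hFin s hs hi, enorm_prodC, ← Finset.prod_pow]
    simp only [enorm_real_sq]
  have hN := lintegral_unfold (fun s => ‖F s‖ₑ ^ 2) (hF.enorm.pow_const 2)
  have hfin : ∫⁻ s, ‖F s‖ₑ ^ 2 ≠ ⊤ := by
    set X : ℝ≥0∞ := ∑' j, ENNReal.ofReal (D j) with hX
    have hXt : X ≠ ⊤ := hD.tsum_ofReal_ne_top
    rw [hN]
    refine ne_top_of_le_ne_top (b := ∫⁻ _ in box n, (X * X) ^ n) ?_ ?_
    · rw [setLIntegral_const, vol_box, mul_one]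
      exact ENNReal.pow_ne_top (ENNReal.mul_ne_top hXt hXt)
    · refine setLIntegral_mono' (measurableSet_box n) fun s hs => ?_
      by_cases hi : ∀ i, s i ∈ Set.Ioc u v
      · rw [hsq s hs hi]
        calc _ ≤ ∏ i : Fin n, X * X := by
              refine Finset.prod_le_prod' fun i _ => ?_
              rw [hX, ← ENNReal.tsum_mul_right]
              refine ENNReal.tsum_le_tsum fun j => ?_
              have hb := (hφ (s i) (hi i)).2.1 j
              rw [← sq_abs, ENNReal.ofReal_pow (abs_nonneg _), pow_two]
              refine mul_le_mul' (ENNReal.ofReal_le_ofReal hb) ?_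
              exact (ENNReal.ofReal_le_ofReal hb).trans
                (ENNReal.le_tsum (f := fun j => ENNReal.ofReal (D j)) j)
          _ = _ := by simp
      · simp [hFout s hs hi]
  refine ⟨F, hF, hfin, ?_, ?_⟩
  · intro h0
    rw [lintegral_eq_zero_iff (hF.enorm.pow_const 2)] at h0
    have hvol : volume (Set.univ.pi (fun _ : Fin n => Set.Ioc u v)) ≠ 0 := by
      rw [volume_pi_pi]
      simp [Finset.prod_eq_zero_iff, huv]
    apply hvol
    refine measure_mono_null ?_ (ae_iff.mp h0)
    intro s hs
    have hs' : ∀ i, s i ∈ Set.Ioc u v := fun i => hs i (Set.mem_univ i)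
    have hsb : s ∈ box n := fun i => ⟨lt_of_le_of_lt hu (hs' i).1, (hs' i).2.trans hv⟩
    have h1 := hFin s hsb hs' 0
    have hz : s + iC (0 : Fin n → ℤ) = s := by ext i; simp [iC]
    rw [hz] at h1
    have : F s ≠ 0 := by
      rw [h1]
      refine Finset.prod_ne_zero_iff.mpr fun i _ => ?_
      exact_mod_cast (hφ (s i) (hs' i)).1
    change ¬ (‖F s‖ₑ ^ 2 = 0)
    simpa using this
  · rw [SS, star_id ha hρ0 F hF hfin, hN, ← lintegral_const_mul' _ _ ENNReal.ofReal_ne_top]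
    refine setLIntegral_mono' (measurableSet_box n) fun s hs => ?_
    by_cases hi : ∀ i, s i ∈ Set.Ioc u v
    · rw [hsq s hs hi]
      have hk : ∀ k : Fin n → ℤ, ‖∑' l, F (s + iC l) * (gR a ρ s k l : ℂ)‖ₑ ^ 2 =
          ∏ i, ENNReal.ofReal ((∑' l : ℤ, φ (s i) l * Real.exp (-a * (s i + l - ρ * k i) ^ 2)) ^ 2) := by
        intro k
        set w : Fin n → ℤ → ℂ := fun i j =>
          ((φ (s i) j * Real.exp (-a * (s i + j - ρ * k i) ^ 2) : ℝ) : ℂ) with hw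
        have hws : ∀ i, Summable fun j => ‖w i j‖ := by
          intro i
          refine Summable.of_nonneg_of_le (fun _ => norm_nonneg _) (fun j => ?_) hD
          simp only [hw]
          rw [Complex.norm_real, Real.norm_eq_abs, abs_mul, Real.abs_exp]
          have hb := (hφ (s i) (hi i)).2.1 j
          have he : Real.exp (-a * (s i + j - ρ * k i) ^ 2) ≤ 1 := by
            rw [Real.exp_le_one_iff]
            nlinarith [sq_nonneg (s i + j - ρ * k i)]
          calc _ ≤ |φ (s i) j| * 1 := by gcongr
            _ ≤ D j := by simpa using hb
        have ht : ∀ l : Fin n → ℤ, F (s + iC l) * (gR a ρ s k l : ℂ) = ∏ i, w i (l i) := by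
          intro l
          rw [hFin s hs hi, gR, Complex.ofReal_prod, ← Finset.prod_mul_distrib]
          simp only [hw, Complex.ofReal_mul]
        simp only [ht]
        rw [(tsum_pi_complex n w hws).2, enorm_prodC, ← Finset.prod_pow]
        refine Finset.prod_congr rfl fun i _ => ?_
        simp only [hw]
        rw [← Complex.ofReal_tsum, enorm_real_sq]
      simp only [hk]
      rw [tsum_pi_ennreal n (fun i j => ENNReal.ofReal
        ((∑' l : ℤ, φ (s i) l * Real.exp (-a * (s i + l - ρ * j) ^ 2)) ^ 2))]
      calc _ ≤ ∏ i, (ENNReal.ofReal ε * ∑' j : ℤ, ENNReal.ofReal (φ (s i) j ^ 2)) :=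
            Finset.prod_le_prod' fun i _ => (hφ (s i) (hi i)).2.2
        _ = ENNReal.ofReal ε ^ n * ∏ i, ∑' j : ℤ, ENNReal.ofReal (φ (s i) j ^ 2) := by
            rw [Finset.prod_mul_distrib]; simp
        _ ≤ _ := by
            gcongr
            refine pow_le_of_le_one zero_le ?_ (by omega)
            exact ENNReal.ofReal_le_one.mpr hε1
    · simp [hFout s hs hi]

lemma l2_int_eq {n : ℕ} {β : ℝ} (hβ : 0 < β) (h : (Fin n → ℝ) → ℂ) :
    ∫ t, h t = ((β ^ n : ℝ) : ℂ)⁻¹ * ∫ s, h (β⁻¹ • s) := by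
  rw [Measure.integral_comp_smul]
  simp only [Module.finrank_fin_fun, inv_pow, inv_inv]
  rw [abs_of_pos (by positivity), Complex.real_smul, ← mul_assoc, inv_mul_cancel₀, one_mul]
  exact_mod_cast (by positivity : β ^ n ≠ 0)

lemma inner_eq {n : ℕ} {α β : ℝ} (hβ : 0 < β) (f : (Fin n → ℝ) → ℂ)
    (km : (Fin n → ℤ) × (Fin n → ℤ)) :
    ‖l2inner f (gaborAtom α β (ψ₀ (n := n)) km)‖ₑ ^ 2 =
      ENNReal.ofReal (((β ^ n)⁻¹ * 2 ^ ((n : ℝ) / 4)) ^ 2) *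
      ‖∫ s, ch km.2 s * (f (β⁻¹ • s) * (gR (Real.pi / β ^ 2) (α * β) s km.1 0 : ℂ))‖ₑ ^ 2 := by
  obtain ⟨k, m⟩ := km
  set c : ℂ := Complex.exp (2 * (Real.pi : ℂ) * Complex.I *
    ((∑ i, (m i : ℝ) * (α * β * k i) : ℝ) : ℂ)) with hc
  have hcn : ‖c‖ = 1 := by
    rw [hc, show 2 * (Real.pi : ℂ) * Complex.I * ((∑ i, (m i : ℝ) * (α * β * k i) : ℝ) : ℂ) =
      ((2 * Real.pi * ∑ i, (m i : ℝ) * (α * β * k i) : ℝ) : ℂ) * Complex.I by push_cast; ring]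
    exact Complex.norm_exp_ofReal_mul_I _
  have hβ' : β ≠ 0 := hβ.ne'
  have key : ∀ s : Fin n → ℝ, f (β⁻¹ • s) * conj (gaborAtom α β (ψ₀ (n := n)) (k, m) (β⁻¹ • s)) =
      (c * (((2 : ℝ) ^ ((n : ℝ) / 4) : ℝ) : ℂ)) *
      (ch m s * (f (β⁻¹ • s) * (gR (Real.pi / β ^ 2) (α * β) s k 0 : ℂ))) := by
    intro s
    have h1 : conj (gaborAtom α β (ψ₀ (n := n)) (k, m) (β⁻¹ • s)) =
        (c * ch m s) * ((((2 : ℝ) ^ ((n : ℝ) / 4) : ℝ) : ℂ) *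
          (gR (Real.pi / β ^ 2) (α * β) s k 0 : ℂ)) := by
      simp only [gaborAtom, Tr, Mo, ψ₀, map_mul, ← Complex.exp_conj, Complex.conj_ofReal]
      have e1 : (starRingEnd ℂ) 2 = 2 := Complex.conj_ofNat 2
      congr 1
      · rw [hc, ch, ← Complex.exp_add, Complex.conj_I, e1]
        congr 1
        rw [show dot (β • iC m) (β⁻¹ • s - α • iC k) =
          ∑ i, (m i : ℝ) * s i - ∑ i, (m i : ℝ) * (α * β * k i) from ?_]
        · push_cast; ring
        · unfold dot
          rw [← Finset.sum_sub_distrib]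
          refine Finset.sum_congr rfl fun i _ => ?_
          simp only [Pi.smul_apply, Pi.sub_apply, iC, smul_eq_mul]
          field_simp
      · congr 1
        rw [← Complex.ofReal_exp, gR, ← Real.exp_sum]
        congr 2
        unfold sq
        rw [Finset.mul_sum, ← Finset.sum_neg_distrib]
        refine Finset.sum_congr rfl fun i _ => ?_
        simp only [Pi.smul_apply, Pi.sub_apply, iC, smul_eq_mul, Pi.zero_apply, Int.cast_zero,
          add_zero]
        field_simp
    rw [h1]; ring
  rw [l2inner, l2_int_eq hβ]
  simp only [key]
  rw [integral_const_mul, ← mul_assoc, enorm_mul, mul_pow]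
  congr 1
  rw [← ofReal_norm, ← ENNReal.ofReal_pow (norm_nonneg _), norm_mul, norm_mul, hcn, norm_inv,
    Complex.norm_real, Complex.norm_real, Real.norm_eq_abs, Real.norm_eq_abs,
    abs_of_pos (by positivity), abs_of_pos (by positivity), one_mul]

lemma norm_eq {n : ℕ} {β : ℝ} (hβ : 0 < β) (f : (Fin n → ℝ) → ℂ) (hf : MemLp f 2 volume)
    (hm : Measurable f) :
    ∫⁻ s : Fin n → ℝ, ‖f (β⁻¹ • s)‖ₑ ^ 2 = ENNReal.ofReal (β ^ n) * ENNReal.ofReal (l2normSq f) := by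
  have h1 : ∫⁻ t, ‖f t‖ₑ ^ 2 = ENNReal.ofReal (l2normSq f) := by
    rw [l2normSq, ofReal_integral_eq_lintegral_ofReal]
    · congr 1; ext x
      rw [ENNReal.ofReal_pow (norm_nonneg _), ofReal_norm]
    · exact hf.integrable_norm_pow (by norm_num)
    · exact ae_of_all _ fun _ => by positivity
  have hmap := Measure.map_addHaar_smul (volume : Measure (Fin n → ℝ)) (inv_ne_zero hβ.ne')
  have := lintegral_map (μ := volume) (f := fun t => ‖f t‖ₑ ^ 2) (hm.enorm.pow_const 2)
    (g := fun s : Fin n → ℝ => β⁻¹ • s) (measurable_const_smul _)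
  rw [← this, hmap, lintegral_smul_measure, h1]
  simp only [Module.finrank_fin_fun, inv_pow, inv_inv]
  rw [abs_of_pos (by positivity), smul_eq_mul]

lemma sum_eq {n : ℕ} {α β : ℝ} (hβ : 0 < β) (f : (Fin n → ℝ) → ℂ) :
    ∑' km, (‖l2inner f (gaborAtom α β (ψ₀ (n := n)) km)‖₊ : ℝ≥0∞) ^ 2 =
      ENNReal.ofReal (((β ^ n)⁻¹ * 2 ^ ((n : ℝ) / 4)) ^ 2) *
      SS (Real.pi / β ^ 2) (α * β) (fun s => f (β⁻¹ • s)) := by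
  rw [SS, ← ENNReal.tsum_mul_left]
  congr 1; ext km
  exact inner_eq hβ f km

lemma frame_of_measurable {n : ℕ} {ι : Type} (A B : ℝ) (atom : ι → Rn n → ℂ)
    (h : ∀ f : Rn n → ℂ, MemLp f 2 volume → Measurable f →
      ENNReal.ofReal (A * l2normSq f) ≤ ∑' i, (‖l2inner f (atom i)‖₊ : ℝ≥0∞) ^ 2 ∧
      ∑' i, (‖l2inner f (atom i)‖₊ : ℝ≥0∞) ^ 2 ≤ ENNReal.ofReal (B * l2normSq f)) :
    FrameBounds A B atom := by
  intro f hf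
  have hae := hf.1.ae_eq_mk
  have hg := h (hf.1.mk f) (hf.ae_eq hae) hf.1.stronglyMeasurable_mk.measurable
  have e1 : l2normSq (hf.1.mk f) = l2normSq f := by
    refine integral_congr_ae ?_
    filter_upwards [hae] with x hx
    rw [hx]
  have e2 : ∀ i, l2inner (hf.1.mk f) (atom i) = l2inner f (atom i) := by
    intro i
    refine integral_congr_ae ?_
    filter_upwards [hae] with x hx
    rw [hx]
  simpa only [e1, e2] using hg

lemma l2normSq_nonneg {n : ℕ} (f : Rn n → ℂ) : 0 ≤ l2normSq f :=
  integral_nonneg fun _ => by positivity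

lemma memLp_smul {n : ℕ} {β : ℝ} (hβ : 0 < β) (F : (Fin n → ℝ) → ℂ) (hF : Measurable F)
    (hfin : ∫⁻ s, ‖F s‖ₑ ^ 2 ≠ ⊤) : MemLp (fun t => F (β • t)) 2 volume := by
  have hm : Measurable (fun t => F (β • t)) := hF.comp (measurable_const_smul β)
  refine ⟨hm.aestronglyMeasurable, ?_⟩
  rw [eLpNorm_lt_top_iff_lintegral_rpow_enorm_lt_top (by norm_num) (by norm_num)]
  simp only [ENNReal.toReal_ofNat, ENNReal.rpow_ofNat]
  have hmap := Measure.map_addHaar_smul (volume : Measure (Fin n → ℝ)) hβ.ne'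
  have := lintegral_map (μ := volume) (f := fun t => ‖F t‖ₑ ^ 2) (hF.enorm.pow_const 2)
    (g := fun s : Fin n → ℝ => β • s) (measurable_const_smul _)
  rw [← this, hmap, lintegral_smul_measure, smul_eq_mul]
  exact lt_top_iff_ne_top.mpr (ENNReal.mul_ne_top ENNReal.ofReal_ne_top hfin)

/-- the Gabor system 𝒢(ψ₀,α,β) with the standard Gaussian ψ₀ is a frame for
L²(ℝⁿ) if and only if αβ < 1. -/
theorem stmt0 (n : ℕ) (hn : 1 ≤ n) (α β : ℝ) (hα : 0 < α) (hβ : 0 < β) :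
    IsFrame (gaborAtom α β (ψ₀ (n := n))) ↔ α * β < 1 := by
  have ha : 0 < Real.pi / β ^ 2 := by positivity
  have hρ : 0 < α * β := by positivity
  set c : ℝ := ((β ^ n)⁻¹ * 2 ^ ((n : ℝ) / 4)) ^ 2 with hc
  have hc0 : 0 < c := by positivity
  have hb0 : 0 < β ^ n := by positivity
  have hid : ∀ (F : (Fin n → ℝ) → ℂ), (fun s => (fun t => F (β • t)) (β⁻¹ • s)) = F := by
    intro F
    ext s
    simp only [smul_smul, mul_inv_cancel₀ hβ.ne', one_smul]
  constructor
  · rintro ⟨A, B, hA, hAB, hfr⟩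
    by_contra hcon
    push Not at hcon
    set ε : ℝ := min 1 (A / (2 * (c * β ^ n))) with hε
    have hε0 : 0 < ε := lt_min one_pos (by positivity)
    obtain ⟨F, hF, hfin, hne, hSS⟩ := SS_counter n hn ha hcon hε0 (min_le_left _ _)
    have hmem := memLp_smul hβ F hF hfin
    have hm : Measurable (fun t => F (β • t)) := hF.comp (measurable_const_smul β)
    have h1 := (hfr _ hmem).1
    have h2 := norm_eq hβ _ hmem hm
    rw [sum_eq hβ, hid F] at h1
    have h2' : ∫⁻ s, ‖F s‖ₑ ^ 2 = ENNReal.ofReal (β ^ n) *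
        ENNReal.ofReal (l2normSq fun t => F (β • t)) := by
      rw [← h2]
      exact congrArg (fun G : (Fin n → ℝ) → ℂ => ∫⁻ s, ‖G s‖ₑ ^ 2) (hid F).symm
    set N := l2normSq fun t => F (β • t) with hNdef
    have hN0 : 0 < N := by
      by_contra hN
      apply hne
      rw [h2', ENNReal.ofReal_of_nonpos (not_lt.mp hN), mul_zero]
    rw [h2'] at hSS
    have h3 : ENNReal.ofReal (A * N) ≤ ENNReal.ofReal (c * (ε * (β ^ n * N))) := by
      refine h1.trans ?_
      rw [ENNReal.ofReal_mul hc0.le, ENNReal.ofReal_mul hε0.le, ENNReal.ofReal_mul hb0.le]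
      gcongr
    rw [ENNReal.ofReal_le_ofReal_iff (by positivity)] at h3
    have h4 : ε * (2 * (c * β ^ n)) ≤ A := by
      rw [← le_div_iff₀ (by positivity)]
      exact min_le_right _ _
    have h5 : A * N ≤ A / 2 * N := by
      refine h3.trans ?_
      have : c * (ε * (β ^ n * N)) = (ε * (2 * (c * β ^ n))) / 2 * N := by ring
      rw [this]
      gcongr
    nlinarith
  · intro hlt
    obtain ⟨K1, hK1, hup⟩ := SS_upper n ha hρ
    obtain ⟨K2, hK2, hlow⟩ := SS_lower n ha hρ hlt
    set A : ℝ := c * β ^ n / (K2.toReal + 1) with hA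
    set B0 : ℝ := c * (K1.toReal * β ^ n) with hB0
    have hK2' : 0 < K2.toReal + 1 := by positivity
    refine ⟨A, max A B0, by positivity, le_max_left _ _, ?_⟩
    refine frame_of_measurable _ _ _ fun f hf hm => ?_
    have hN := l2normSq_nonneg f
    have hFm : Measurable (fun s : Fin n → ℝ => f (β⁻¹ • s)) := hm.comp (measurable_const_smul _)
    have h2 := norm_eq hβ f hf hm
    have hfin : ∫⁻ s : Fin n → ℝ, ‖f (β⁻¹ • s)‖ₑ ^ 2 ≠ ⊤ := by
      rw [h2]; exact ENNReal.mul_ne_top ENNReal.ofReal_ne_top ENNReal.ofReal_ne_top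
    have hu := hup _ hFm hfin
    have hl := hlow _ hFm hfin
    rw [h2] at hu hl
    rw [sum_eq hβ]
    constructor
    · rw [show A * l2normSq f = c * ((K2.toReal + 1)⁻¹ * (β ^ n * l2normSq f)) by
        rw [hA]; field_simp]
      rw [ENNReal.ofReal_mul hc0.le, ENNReal.ofReal_mul (by positivity),
        ENNReal.ofReal_mul hb0.le, ENNReal.ofReal_inv_of_pos hK2']
      gcongr
      rw [mul_comm, ← div_eq_mul_inv]
      refine ENNReal.div_le_of_le_mul' (hl.trans ?_)
      gcongr
      rw [ENNReal.ofReal_add ENNReal.toReal_nonneg zero_le_one, ENNReal.ofReal_toReal hK2]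
      exact le_self_add
    · calc _ ≤ ENNReal.ofReal c * (K1 * (ENNReal.ofReal (β ^ n) * ENNReal.ofReal (l2normSq f))) := by
            gcongr
        _ = ENNReal.ofReal (B0 * l2normSq f) := by
            rw [show B0 * l2normSq f = c * (K1.toReal * (β ^ n * l2normSq f)) by rw [hB0]; ring]
            rw [ENNReal.ofReal_mul hc0.le, ENNReal.ofReal_mul ENNReal.toReal_nonneg,
              ENNReal.ofReal_mul hb0.le, ENNReal.ofReal_toReal hK1]
        _ ≤ _ := by
            refine ENNReal.ofReal_le_ofReal ?_
            gcongr
            exact le_max_right _ _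

end SC
end
end

section
/- Let Λ=Mℤ^{2n} with M an invertible 2n×2n real matrix, let g,γ∈L²(ℝⁿ), ħ∈(0,1], h=2πħ. Then 𝒢(γ,Λ)={𝒯̂(z)γ : z∈Λ} is a dual frame of the Gabor frame 𝒢(g,Λ)={𝒯̂(z)g : z∈Λ} if and only if 𝒢^ħ(γ^h, h^{1/2}Λ)={𝒯̂^ħ(w)γ^h : w∈h^{1/2}Λ} is a dual frame of the ħ-Gabor frame 𝒢^ħ(g^h, h^{1/2}Λ)={𝒯̂^ħ(w)g^h : w∈h^{1/2}Λ}. Moreover 0<A≤B are frame bounds of 𝒢(g,Λ) if and only if they are frame bounds of 𝒢^ħ(g^h,h^{1/2}Λ), and the same holds for the dual frames 𝒢(γ,Λ) and 𝒢^ħ(γ^h,h^{1/2}Λ). -/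
noncomputable section
open MeasureTheory Filter Complex Real
open scoped ComplexConjugate BigOperators NNReal ENNReal

namespace SC

variable {n : ℕ}

/-- unconditional convergence in L²: the partial sums of the series Σ F i converge to f
in the L² norm along the net of finite subsets. -/
def ConvL2 {ι : Type} (f : Rn n → ℂ) (F : ι → Rn n → ℂ) : Prop :=
  Filter.Tendsto (fun s : Finset ι => ∫ t, ‖f t - ∑ i ∈ s, F i t‖ ^ 2)
    Filter.atTop (nhds 0)

/-- `atomγ` is a dual frame of the frame `atomg`: both are frames and every f ∈ L²
has the expansion f = Σ_i ⟨f, atomg i⟩ atomγ i in L². -/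
def IsDualFrame {ι : Type} (atomγ atomg : ι → Rn n → ℂ) : Prop :=
  IsFrame atomg ∧ IsFrame atomγ ∧
  ∀ f : Rn n → ℂ, MemLp f 2 volume →
    ConvL2 f (fun i => fun t => l2inner f (atomg i) * atomγ i t)

/-- the point of the lattice Λ = Mℤ^{2n} indexed by (k,l) ∈ ℤⁿ×ℤⁿ. -/
def lattOf (M : Matrix (Fin n ⊕ Fin n) (Fin n ⊕ Fin n) ℝ)
    (k : (Fin n → ℤ) × (Fin n → ℤ)) : Ph n :=
  (fun i => M.mulVec (Sum.elim (fun j => (k.1 j : ℝ)) (fun j => (k.2 j : ℝ))) (Sum.inl i),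
   fun i => M.mulVec (Sum.elim (fun j => (k.1 j : ℝ)) (fun j => (k.2 j : ℝ))) (Sum.inr i))

lemma Dil_Dil_inv {d : ℝ} (hd : 0 < d) (f : Rn n → ℂ) : Dil d (Dil d⁻¹ f) = f := by
  funext x
  have h1 : d ^ ((n : ℝ) / 2) * d⁻¹ ^ ((n : ℝ) / 2) = 1 := by
    rw [← Real.mul_rpow hd.le (inv_nonneg.mpr hd.le), mul_inv_cancel₀ hd.ne', Real.one_rpow]
  simp only [Dil]
  rw [← mul_assoc, ← Complex.ofReal_mul, h1, smul_smul, inv_mul_cancel₀ hd.ne']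
  simp

lemma Dil_inv_Dil {d : ℝ} (hd : 0 < d) (f : Rn n → ℂ) : Dil d⁻¹ (Dil d f) = f := by
  have := Dil_Dil_inv (inv_pos.mpr hd) f
  rwa [inv_inv] at this

lemma rpow_half_sq {d : ℝ} (hd : 0 < d) :
    d ^ ((n : ℝ) / 2) * d ^ ((n : ℝ) / 2) = d ^ n := by
  rw [← Real.rpow_add hd, add_halves, Real.rpow_natCast]

lemma l2inner_Dil {d : ℝ} (hd : 0 < d) (f g : Rn n → ℂ) :
    l2inner (Dil d f) (Dil d g) = l2inner f g := by
  have h1 : ∀ t : Rn n, Dil d f t * conj (Dil d g t)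
      = ((d ^ n : ℝ) : ℂ) * (fun s => f s * conj (g s)) (d • t) := by
    intro t
    simp only [Dil, map_mul, Complex.conj_ofReal]
    rw [← rpow_half_sq hd]
    push_cast
    ring
  have hp : (0 : ℝ) < d ^ n := pow_pos hd n
  unfold l2inner
  simp_rw [h1]
  rw [integral_const_mul, Measure.integral_comp_smul volume (fun s : Rn n => f s * conj (g s)) d]
  simp only [Module.finrank_fintype_fun_eq_card, Fintype.card_fin]
  rw [abs_of_pos (inv_pos.mpr hp), Complex.real_smul, ← mul_assoc, ← Complex.ofReal_mul,
    mul_inv_cancel₀ hp.ne']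
  simp

lemma l2normSq_Dil {d : ℝ} (hd : 0 < d) (f : Rn n → ℂ) :
    l2normSq (Dil d f) = l2normSq f := by
  have h1 : ∀ t : Rn n, ‖Dil d f t‖ ^ 2 = d ^ n * (fun s => ‖f s‖ ^ 2) (d • t) := by
    intro t
    simp only [Dil, norm_mul, Complex.norm_real]
    rw [← rpow_half_sq hd, Real.norm_of_nonneg (Real.rpow_nonneg hd.le _)]
    ring
  have hp : (0 : ℝ) < d ^ n := pow_pos hd n
  unfold l2normSq
  simp_rw [h1]
  rw [integral_const_mul, Measure.integral_comp_smul volume (fun s : Rn n => ‖f s‖ ^ 2) d]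
  simp only [Module.finrank_fintype_fun_eq_card, Fintype.card_fin]
  rw [abs_of_pos (inv_pos.mpr hp), smul_eq_mul, ← mul_assoc, mul_inv_cancel₀ hp.ne', one_mul]

lemma memLp_Dil {d : ℝ} (hd : 0 < d) {f : Rn n → ℂ} (hf : MemLp f 2 volume) :
    MemLp (Dil d f) 2 volume := by
  have hp : (0 : ℝ) < d ^ n := pow_pos hd n
  have hmap : Measure.map (fun x : Rn n => d • x) volume
      = ENNReal.ofReal |(d ^ n)⁻¹| • volume := by
    have := Measure.map_addHaar_smul (volume : Measure (Rn n)) hd.ne'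
    simpa using this
  have h2 : MemLp f 2 (Measure.map (fun x : Rn n => d • x) volume) := by
    rw [hmap]
    exact hf.smul_measure ENNReal.ofReal_ne_top
  have h3 : MemLp (f ∘ fun x : Rn n => d • x) 2 volume :=
    h2.comp_of_map (measurable_const_smul d).aemeasurable
  exact h3.const_mul _

lemma FrameBounds_Dil {ι : Type} {d : ℝ} (hd : 0 < d) {A B : ℝ} {atom : ι → Rn n → ℂ}
    (H : FrameBounds A B atom) : FrameBounds A B (fun i => Dil d (atom i)) := by
  intro f hf
  have := H (Dil d⁻¹ f) (memLp_Dil (inv_pos.mpr hd) hf)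
  rw [l2normSq_Dil (inv_pos.mpr hd)] at this
  have h2 : ∀ i, l2inner (Dil d⁻¹ f) (atom i) = l2inner f (Dil d (atom i)) := by
    intro i
    rw [← l2inner_Dil hd, Dil_Dil_inv hd]
  simpa only [h2] using this

lemma FrameBounds_Dil_iff {ι : Type} {d : ℝ} (hd : 0 < d) {A B : ℝ} {atom : ι → Rn n → ℂ} :
    FrameBounds A B atom ↔ FrameBounds A B (fun i => Dil d (atom i)) := by
  refine ⟨FrameBounds_Dil hd, fun H => ?_⟩
  simpa only [Dil_inv_Dil hd] using FrameBounds_Dil (inv_pos.mpr hd) H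

lemma IsDualFrame_Dil {ι : Type} {d : ℝ} (hd : 0 < d) {a b : ι → Rn n → ℂ}
    (H : IsDualFrame a b) :
    IsDualFrame (fun i => Dil d (a i)) (fun i => Dil d (b i)) := by
  obtain ⟨⟨A, B, hA, hB, h1⟩, ⟨A', B', hA', hB', h1'⟩, h3⟩ := H
  refine ⟨⟨A, B, hA, hB, FrameBounds_Dil hd h1⟩, ⟨A', B', hA', hB', FrameBounds_Dil hd h1'⟩, ?_⟩
  intro f hf
  have h4 := h3 (Dil d⁻¹ f) (memLp_Dil (inv_pos.mpr hd) hf)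
  have h2 : ∀ i, l2inner (Dil d⁻¹ f) (b i) = l2inner f (Dil d (b i)) := by
    intro i
    rw [← l2inner_Dil hd, Dil_Dil_inv hd]
  unfold ConvL2 at h4 ⊢
  refine h4.congr fun s => ?_
  have h5 := l2normSq_Dil hd (fun t => Dil d⁻¹ f t - ∑ i ∈ s, l2inner (Dil d⁻¹ f) (b i) * a i t)
  unfold l2normSq at h5
  rw [← h5]
  congr 1
  funext t
  congr 2
  have h6 : f t = Dil d (Dil d⁻¹ f) t := by rw [Dil_Dil_inv hd]
  simp only [← h2]
  rw [h6]
  generalize Dil d⁻¹ f = F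
  simp only [Dil, mul_sub, Finset.mul_sum]
  congr 1
  exact Finset.sum_congr rfl fun i _ => by ring

lemma IsDualFrame_Dil_iff {ι : Type} {d : ℝ} (hd : 0 < d) {a b : ι → Rn n → ℂ} :
    IsDualFrame a b ↔ IsDualFrame (fun i => Dil d (a i)) (fun i => Dil d (b i)) := by
  refine ⟨IsDualFrame_Dil hd, fun H => ?_⟩
  simpa only [Dil_inv_Dil hd] using IsDualFrame_Dil (inv_pos.mpr hd) H

lemma WH_gh {hbar h : ℝ} (hbar0 : 0 < hbar) (hh : h = 2 * Real.pi * hbar) (z : Ph n)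
    (g : Rn n → ℂ) :
    WH hbar (Real.sqrt h • z) (gh h g) = Dil (Real.sqrt h)⁻¹ (T1 z g) := by
  have hpos : 0 < h := by rw [hh]; positivity
  have hc : 0 < Real.sqrt h := Real.sqrt_pos.mpr hpos
  have hcc : Real.sqrt h * Real.sqrt h = 2 * Real.pi * hbar := by
    rw [Real.mul_self_sqrt hpos.le, hh]
  generalize hce : Real.sqrt h = c at hc hcc
  funext x
  have e1 : dot (c • z).2 x = c * dot z.2 x := by
    simp [dot, Finset.mul_sum, mul_assoc]
  have e2 : dot (c • z).1 (c • z).2 = (c * c) * dot z.1 z.2 := by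
    simp only [dot, Finset.mul_sum, Prod.smul_fst, Prod.smul_snd, Pi.smul_apply, smul_eq_mul]
    exact Finset.sum_congr rfl fun i _ => by ring
  have e3 : dot z.2 (c⁻¹ • x) = c⁻¹ * dot z.2 x := by
    simp only [dot, Finset.mul_sum, Pi.smul_apply, smul_eq_mul]
    exact Finset.sum_congr rfl fun i _ => by ring
  have e4 : c⁻¹ • (x - (c • z).1) = c⁻¹ • x - z.1 := by
    rw [smul_sub, Prod.smul_fst, smul_smul, inv_mul_cancel₀ hc.ne', one_smul]
  have k1 : hbar⁻¹ * (c * c) = 2 * Real.pi := by rw [hcc]; field_simp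
  have k2 : hbar⁻¹ * c = 2 * Real.pi * c⁻¹ := by rw [← k1]; field_simp
  have e5 : hbar⁻¹ * (c * dot z.2 x - (c * c) * dot z.1 z.2 / 2)
      = (1 / (2 * Real.pi))⁻¹ * (c⁻¹ * dot z.2 x - dot z.1 z.2 / 2) := by
    rw [one_div, inv_inv]
    linear_combination (dot z.2 x) * k2 - (dot z.1 z.2 / 2) * k1
  simp only [WH, gh, T1, Dil, hce]
  rw [e1, e2, e3, e4, e5]
  ring

/-- 𝒢(γ,Λ) is a dual frame of the Gabor frame 𝒢(g,Λ) iff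
𝒢^ħ(γ^h, h^{1/2}Λ) is a dual frame of the ħ-Gabor frame 𝒢^ħ(g^h, h^{1/2}Λ); moreover
A, B are frame bounds of 𝒢(g,Λ) iff they are frame bounds of 𝒢^ħ(g^h, h^{1/2}Λ), and
the same holds for the dual windows γ, γ^h. -/
theorem stmt3 (n : ℕ) (M : Matrix (Fin n ⊕ Fin n) (Fin n ⊕ Fin n) ℝ) (hM : IsUnit M.det)
    (g γ : Rn n → ℂ) (hg : MemLp g 2 volume) (hγ : MemLp γ 2 volume)
    (hbar : ℝ) (hbar0 : 0 < hbar) (hbar1 : hbar ≤ 1)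
    (h : ℝ) (hh : h = 2 * Real.pi * hbar) :
    (IsDualFrame (fun k => T1 (lattOf M k) γ) (fun k => T1 (lattOf M k) g) ↔
      IsDualFrame (fun k => WH hbar (Real.sqrt h • lattOf M k) (gh h γ))
        (fun k => WH hbar (Real.sqrt h • lattOf M k) (gh h g))) ∧
    (∀ A B : ℝ, 0 < A → A ≤ B →
      (FrameBounds A B (fun k => T1 (lattOf M k) g) ↔
        FrameBounds A B (fun k => WH hbar (Real.sqrt h • lattOf M k) (gh h g)))) ∧
    (∀ A B : ℝ, 0 < A → A ≤ B →
      (FrameBounds A B (fun k => T1 (lattOf M k) γ) ↔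
        FrameBounds A B (fun k => WH hbar (Real.sqrt h • lattOf M k) (gh h γ)))) := by
  have hpos : 0 < h := by rw [hh]; positivity
  have hd : 0 < (Real.sqrt h)⁻¹ := inv_pos.mpr (Real.sqrt_pos.mpr hpos)
  simp only [WH_gh hbar0 hh]
  exact ⟨IsDualFrame_Dil_iff hd, fun A B _ _ => FrameBounds_Dil_iff hd,
    fun A B _ _ => FrameBounds_Dil_iff hd⟩

end SC
end
end

section
/- Let α,β>0 with αβ<1, Λ=αℤⁿ×βℤⁿ, ħ∈(0,1], h=2πħ. Let ψ₀(x)=2^{n/4}e^{−π|x|²}, φ₀^ħ=D_{h^{−1/2}}ψ₀, and suppose γ₀∈𝒮(ℝⁿ) is such that 𝒢(γ₀,Λ) is a dual frame of the Gabor frame 𝒢(ψ₀,Λ). Then 𝒢^ħ(γ₀^h, h^{1/2}Λ) is a dual frame of the ħ-Gabor frame 𝒢^ħ(φ₀^ħ, h^{1/2}Λ); moreover, 0<A≤B are frame bounds of 𝒢^ħ(γ₀^h, h^{1/2}Λ) if and only if they are frame bounds of 𝒢(γ₀,Λ); in particular they are independent of ħ. -/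
noncomputable section
open MeasureTheory Filter Complex Real
open scoped ComplexConjugate BigOperators NNReal ENNReal

namespace SC

variable {n : ℕ}

/-- the point of the lattice Λ = αℤⁿ×βℤⁿ indexed by (k,l) ∈ ℤⁿ×ℤⁿ. -/
def latt (α β : ℝ) (k : (Fin n → ℤ) × (Fin n → ℤ)) : Ph n := (α • iC k.1, β • iC k.2)

lemma dil_const {l : ℝ} (hl : 0 < l) : (l ^ ((n : ℝ) / 2)) * (l ^ ((n : ℝ) / 2)) = l ^ n := by
  rw [← Real.rpow_add hl, add_halves, Real.rpow_natCast]

lemma integral_dil {E : Type} [NormedAddCommGroup E] [NormedSpace ℝ E] {l : ℝ} (hl : 0 < l)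
    (F : Rn n → E) : ∫ t, (l ^ n : ℝ) • F (l • t) = ∫ t, F t := by
  rw [integral_smul, Measure.integral_comp_smul]
  have : 0 < l ^ n := by positivity
  simp only [Module.finrank_fin_fun]
  rw [abs_of_pos (by positivity), smul_smul, mul_inv_cancel₀ this.ne', one_smul]

lemma l2inner_dil {l : ℝ} (hl : 0 < l) (f g : Rn n → ℂ) :
    l2inner (Dil l f) (Dil l g) = l2inner f g := by
  unfold l2inner
  rw [← integral_dil hl (fun t => f t * conj (g t))]
  congr 1
  funext t
  simp only [Dil, map_mul, Complex.conj_ofReal, Complex.real_smul]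
  rw [← dil_const hl]
  push_cast
  ring

lemma integral_norm_dil {l : ℝ} (hl : 0 < l) (f : Rn n → ℂ) :
    ∫ t, ‖Dil l f t‖ ^ 2 = ∫ t, ‖f t‖ ^ 2 := by
  rw [← integral_dil hl (fun t => ‖f t‖ ^ 2)]
  congr 1
  funext t
  simp only [Dil, norm_mul, Complex.norm_real, smul_eq_mul, mul_pow]
  rw [← dil_const hl, Real.norm_eq_abs, sq_abs]
  ring

lemma dil_dil {l : ℝ} (hl : 0 < l) (f : Rn n → ℂ) : Dil l (Dil l⁻¹ f) = f := by
  funext t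
  simp only [Dil]
  rw [smul_smul, inv_mul_cancel₀ hl.ne', one_smul, ← mul_assoc, ← Complex.ofReal_mul,
    Real.inv_rpow hl.le, mul_inv_cancel₀ (Real.rpow_pos_of_pos hl _).ne']
  simp

lemma memLp_dil {l : ℝ} (hl : 0 < l) {f : Rn n → ℂ} (hf : MemLp f 2 volume) :
    MemLp (Dil l f) 2 volume := by
  refine MemLp.const_mul (f := fun x => f (l • x)) ?_ _
  have hm : Measure.map (fun x : Rn n => l • x) volume
      = ENNReal.ofReal |(l ^ Module.finrank ℝ (Rn n))⁻¹| • volume :=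
    Measure.map_addHaar_smul volume hl.ne'
  have h1 : MemLp f 2 (Measure.map (fun x : Rn n => l • x) volume) := by
    rw [hm]
    exact hf.smul_measure ENNReal.ofReal_ne_top
  exact h1.comp_of_map (measurable_const_smul l).aemeasurable

lemma frameBounds_dil_aux {ι : Type} {l : ℝ} (hl : 0 < l) {A B : ℝ} {atom : ι → Rn n → ℂ}
    (H : FrameBounds A B atom) : FrameBounds A B (fun i => Dil l (atom i)) := by
  intro f hf
  have h1 := H (Dil l⁻¹ f) (memLp_dil (inv_pos.2 hl) hf)
  have h2 : l2normSq (Dil l⁻¹ f) = l2normSq f := integral_norm_dil (inv_pos.2 hl) f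
  have h3 : ∀ i, l2inner f (Dil l (atom i)) = l2inner (Dil l⁻¹ f) (atom i) := fun i => by
    rw [← l2inner_dil hl (Dil l⁻¹ f), dil_dil hl]
  simp only [h3]
  rwa [h2] at h1

lemma frameBounds_dil {ι : Type} {l : ℝ} (hl : 0 < l) {A B : ℝ} {atom : ι → Rn n → ℂ} :
    FrameBounds A B (fun i => Dil l (atom i)) ↔ FrameBounds A B atom := by
  refine ⟨fun H => ?_, frameBounds_dil_aux hl⟩
  have h1 := frameBounds_dil_aux (inv_pos.2 hl) H
  have h2 : ∀ i, Dil l⁻¹ (Dil l (atom i)) = atom i := fun i => by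
    simpa using dil_dil (inv_pos.2 hl) (atom i)
  simpa only [h2] using h1

lemma isFrame_dil {ι : Type} {l : ℝ} (hl : 0 < l) {atom : ι → Rn n → ℂ} (H : IsFrame atom) :
    IsFrame (fun i => Dil l (atom i)) := by
  obtain ⟨A, B, hA, hAB, hF⟩ := H
  exact ⟨A, B, hA, hAB, frameBounds_dil_aux hl hF⟩

lemma isDualFrame_dil {ι : Type} {l : ℝ} (hl : 0 < l) {a b : ι → Rn n → ℂ}
    (H : IsDualFrame a b) : IsDualFrame (fun i => Dil l (a i)) (fun i => Dil l (b i)) := by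
  obtain ⟨h1, h2, h3⟩ := H
  refine ⟨isFrame_dil hl h1, isFrame_dil hl h2, fun f hf => ?_⟩
  have h4 := h3 (Dil l⁻¹ f) (memLp_dil (inv_pos.2 hl) hf)
  unfold ConvL2 at h4 ⊢
  refine h4.congr fun s => ?_
  rw [← integral_norm_dil hl]
  congr 1
  funext t
  congr 2
  have e1 : ∀ i, l2inner f (Dil l (b i)) = l2inner (Dil l⁻¹ f) (b i) := fun i => by
    rw [← l2inner_dil hl (Dil l⁻¹ f), dil_dil hl]
  have e2 := congrFun (dil_dil hl f) t
  simp only [e1]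
  rw [← e2]
  simp only [Dil, mul_sub, Finset.mul_sum]
  congr 1
  refine Finset.sum_congr rfl fun i _ => ?_
  ring

lemma dot_smul_left (c : ℝ) (x y : Rn n) : dot (c • x) y = c * dot x y := by
  simp only [dot, Finset.mul_sum, Pi.smul_apply, smul_eq_mul, mul_assoc]

lemma dot_smul_right (c : ℝ) (x y : Rn n) : dot x (c • y) = c * dot x y := by
  simp only [dot, Finset.mul_sum, Pi.smul_apply, smul_eq_mul, mul_left_comm]

/-- if γ₀ ∈ 𝒮(ℝⁿ) is such that 𝒢(γ₀,Λ) is a dual frame of 𝒢(ψ₀,Λ),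
Λ = αℤⁿ×βℤⁿ, αβ < 1, then 𝒢^ħ(γ₀^h, h^{1/2}Λ) is a dual frame of the ħ-Gabor frame
𝒢^ħ(φ₀^ħ, h^{1/2}Λ), and A, B are frame bounds of 𝒢^ħ(γ₀^h, h^{1/2}Λ) iff they are frame
bounds of 𝒢(γ₀,Λ); in particular they are independent of ħ. -/
theorem stmt4 (n : ℕ) (α β : ℝ) (hα : 0 < α) (hβ : 0 < β) (hαβ : α * β < 1)
    (hbar : ℝ) (hbar0 : 0 < hbar) (hbar1 : hbar ≤ 1)
    (h : ℝ) (hh : h = 2 * Real.pi * hbar)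
    (γ₀ : SchwartzMap (Rn n) ℂ)
    (hdual : IsDualFrame (fun k => T1 (latt α β k) ⇑γ₀)
      (fun k => T1 (latt α β k) (ψ₀ (n := n)))) :
    IsDualFrame (fun k => WH hbar (Real.sqrt h • latt α β k) (gh h ⇑γ₀))
      (fun k => WH hbar (Real.sqrt h • latt α β k) (gh h (ψ₀ (n := n)))) ∧
    (∀ A B : ℝ, 0 < A → A ≤ B →
      (FrameBounds A B (fun k => WH hbar (Real.sqrt h • latt α β k) (gh h ⇑γ₀)) ↔
        FrameBounds A B (fun k => T1 (latt α β k) ⇑γ₀))) := by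
  have hpos : 0 < h := by rw [hh]; positivity
  have hs : 0 < (Real.sqrt h)⁻¹ := inv_pos.2 (Real.sqrt_pos.2 hpos)
  simp only [WH_gh hbar0 hh]
  exact ⟨isDualFrame_dil hs hdual, fun A B _ _ => frameBounds_dil hs⟩

end SC
end
end
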